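/- Let k be a field. The subspace of the degree-2 component of kQ̄_m^n spanned by the quadratic generators (A)–(D) of Ī_m^n equals the orthogonal complement, with respect to the pairing ⟨−,−⟩, of the subspace of the degree-2 component of kQ_m^n spanned by the quadratic generators (i)–(iii) of I_m^n; that is, a degree-2 element p of kQ̄_m^n lies in the span of the generators of Ī_m^n if and only if ⟨r, p⟩ = 0 for every r in the span of the generators of I_m^n. -/

import Mathlib

open scoped Classical

namespace Kh

abbrev Wt (N : ℕ) := Fin N → Bool

variable {N : ℕ}

/-- A weight of type `(m,n)`: `m` downs (`true`) and `n` ups (`false`). -/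
def IsWeight (m n : ℕ) (l : Wt N) : Prop :=
  {i : Fin N | l i = true}.ncard = m ∧ {i : Fin N | l i = false}.ncard = n

/-- The height of a weight: sum over downs of the number of ups to the left. -/
noncomputable def height (l : Wt N) : ℕ :=
  ∑ i : Fin N, if l i = true then {j : Fin N | j < i ∧ l j = false}.ncard else 0

/-- Number of positions `t` with `i < t ≤ j` and value `b`. -/
noncomputable def cnt (l : Wt N) (b : Bool) (i j : Fin N) : ℕ :=
  {t : Fin N | i < t ∧ t ≤ j ∧ l t = b}.ncard

/-- `(i,j)` is a matched pair ("circle") of the standard non-crossing bracket matching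
of `l` (reading `true` = ↓ as an opening bracket and `false` = ↑ as a closing bracket):
`l i = ↓`, `l j = ↑`, the segment strictly between `i` and `j` is balanced and every
prefix of it has at least as many ↓'s as ↑'s. -/
def IsCircle (l : Wt N) (i j : Fin N) : Prop :=
  i < j ∧ l i = true ∧ l j = false ∧
    cnt l true i j + 1 = cnt l false i j ∧
    ∀ k : Fin N, i < k → k < j → cnt l false i k ≤ cnt l true i k

/-- `s_C(λ)`: exchange the values of `l` at the two positions of the circle `C = (i,j)`. -/
def swapC (l : Wt N) (i j : Fin N) : Wt N :=
  fun t => if t = i then l j else if t = j then l i else l t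

/-- The circle `(i,j)` encloses the circle `(i',j')`. -/
def Encloses (i j i' j' : Fin N) : Prop := i < i' ∧ j' < j

/-- The circle `(i,j)` lies to the left of the circle `(i',j')`. -/
def LeftOf (i j i' j' : Fin N) : Prop := j < i'

/-- The position `p` is unmatched in `l`. -/
def Unmatched (l : Wt N) (p : Fin N) : Prop :=
  ∀ q : Fin N, ¬ IsCircle l p q ∧ ¬ IsCircle l q p

/-- `def(λ)`: the number of circles of `l`. -/
noncomputable def defect (l : Wt N) : ℕ :=
  {p : Fin N × Fin N | IsCircle l p.1 p.2}.ncard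

/-- One step up in the graph `Γ_m^n`: `m' = s_C(l)` for some circle `C` of `l`. -/
def GammaStep (l m' : Wt N) : Prop :=
  ∃ i j : Fin N, IsCircle l i j ∧ m' = swapC l i j

/-- Adjacency in the graph `Γ_m^n`. -/
def GammaAdj (l m' : Wt N) : Prop := GammaStep l m' ∨ GammaStep m' l

/-- The order embedding `Fin N → Fin (N+2)` skipping the two positions `i`, `i+1`;
composing a weight with it deletes these two positions. -/
def skip2 (i : ℕ) {N : ℕ} (t : Fin N) : Fin (N + 2) :=
  if (t : ℕ) < i then Fin.castLE (Nat.le_add_right N 2) t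
  else ⟨(t : ℕ) + 2, Nat.add_lt_add_right t.isLt 2⟩

end Kh

namespace Kh

variable {N : ℕ}

/-- Type (I) elements of `S_m^n`: an ascending arrow into a vertex followed by a
descending arrow out of it (as vertex lists of the corresponding paths in `Q̄_m^n`). -/
def SType1 (p : List (Wt N)) : Prop :=
  ∃ x y z : Wt N, p = [x, y, z] ∧ GammaStep x y ∧ GammaStep z y

/-- Ascending type (II) elements of `S_m^n`: `ȳ_λ^ν ȳ_ν^μ` with `ν = s_C(λ)`,
`μ = s_{C'}(ν)`, where `C'` is a circle of `λ` enclosed in `C` or lying to the right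
of `C`. -/
def SType2Asc (p : List (Wt N)) : Prop :=
  ∃ (la : Wt N) (i j i' j' : Fin N),
    IsCircle la i j ∧ IsCircle la i' j' ∧
    (Encloses i j i' j' ∨ LeftOf i j i' j') ∧
    IsCircle (swapC la i j) i' j' ∧
    p = [la, swapC la i j, swapC (swapC la i j) i' j']

/-- Ascending type (III) elements of `S_m^n` (length `k ≥ 3`), written with 0-based
vertices `v 0, …, v k` (so `λ_t = v (t-1)`) and 1-based circles `C_i = (a i, b i)`. -/
def SType3Asc (p : List (Wt N)) : Prop :=
  ∃ (k : ℕ) (v : ℕ → Wt N) (a b : ℕ → Fin N),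
    3 ≤ k ∧
    p = List.ofFn (fun t : Fin (k + 1) => v t.val) ∧
    (∀ i, 1 ≤ i → i ≤ k →
      IsCircle (v (i - 1)) (a i) (b i) ∧ v i = swapC (v (i - 1)) (a i) (b i)) ∧
    (∀ i, 2 ≤ i → i ≤ k - 1 → ¬ IsCircle (v (i - 2)) (a i) (b i)) ∧
    (∀ j, 1 ≤ j → j ≤ k → IsCircle (v (j - 1)) (a k) (b k)) ∧
    Encloses (a 1) (b 1) (a k) (b k) ∧
    (∀ i, 2 ≤ i → i ≤ k - 1 → LeftOf (a k) (b k) (a i) (b i))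

/-- Membership in the reduction set `S_m^n` (vertex-list model: the descending
elements are the reverses of the ascending ones). -/
def InS (p : List (Wt N)) : Prop :=
  SType1 p ∨ SType2Asc p ∨ SType2Asc p.reverse ∨ SType3Asc p ∨ SType3Asc p.reverse

/-- A path in `Q̄_m^n` (given by its vertex list) is irreducible if no contiguous
subpath of it belongs to `S_m^n`. -/
def Irreducible (p : List (Wt N)) : Prop :=
  ∀ s, s <:+: p → ¬ InS s

/-- The number of ascending irreducible paths of length `k` from `la` to `mu`. -/
noncomputable def ascCount (k : ℕ) (la mu : Wt N) : ℕ :=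
  {p : List (Wt N) | p.length = k + 1 ∧ p.head? = some la ∧ p.getLast? = some mu ∧
    p.Chain' GammaStep ∧ Irreducible p}.ncard

/-- The total number of irreducible paths from `la` to `mu`. -/
noncomputable def irrCount (la mu : Wt N) : ℕ :=
  {p : List (Wt N) | p ≠ [] ∧ p.head? = some la ∧ p.getLast? = some mu ∧
    p.Chain' GammaAdj ∧ Irreducible p}.ncard

end Kh

namespace Kh

/-- The vertex set of `Q̄_m^n`: weights of type `(m,n)`. -/
def V (m n N : ℕ) := {l : Wt N // IsWeight m n l}

/-- The arrow set of `Q̄_m^n`: for adjacent weights there is one arrow in each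
direction (the ascending arrow `ȳ` and the descending arrow `x̄`); an arrow is an
ordered adjacent pair (source, target). -/
def E (m n N : ℕ) := {p : V m n N × V m n N // GammaAdj p.1.1 p.2.1}

/-- The free algebra on the vertices and arrows of `Q̄_m^n`; the path algebra
`kQ̄_m^n` is its quotient by the path-algebra relations `PARel`. -/
abbrev FA (F : Type*) [Field F] (m n N : ℕ) := FreeAlgebra F (V m n N ⊕ E m n N)

noncomputable def eV (F : Type*) [Field F] (m n N : ℕ) (v : V m n N) : FA F m n N :=
  FreeAlgebra.ι F (Sum.inl v)

noncomputable def arE (F : Type*) [Field F] (m n N : ℕ) (a : E m n N) : FA F m n N :=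
  FreeAlgebra.ι F (Sum.inr a)

/-- The idempotent `e_λ` attached to an arbitrary `l : Wt N` (zero if `l` is not
a weight of type `(m,n)`). -/
noncomputable def eW (F : Type*) [Field F] (m n N : ℕ) (l : Wt N) : FA F m n N :=
  if h : IsWeight m n l then eV F m n N ⟨l, h⟩ else 0

/-- The arrow from `u` to `w` (zero if `u`, `w` are not adjacent weights). -/
noncomputable def arW (F : Type*) [Field F] (m n N : ℕ) (u w : Wt N) : FA F m n N :=
  if h : IsWeight m n u ∧ IsWeight m n w ∧ GammaAdj u w then
    arE F m n N ⟨(⟨u, h.1⟩, ⟨w, h.2.1⟩), h.2.2⟩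
  else 0

/-- The element of the (free algebra presenting the) path algebra corresponding to
the path with the given vertex list. -/
noncomputable def pathEl (F : Type*) [Field F] (m n N : ℕ) : List (Wt N) → FA F m n N
  | [] => 0
  | [u] => eW F m n N u
  | u :: w :: rest => arW F m n N u w * pathEl F m n N (w :: rest)

/-- The defining relations of the path algebra `kQ̄_m^n` as a quotient of the free
algebra on vertices and arrows: the vertices are orthogonal idempotents summing to
`1` and each arrow is supported at its source and target. -/
inductive PARel (F : Type*) [Field F] (m n N : ℕ) : FA F m n N → FA F m n N → Prop
  | idem (v : V m n N) : PARel F m n N (eV F m n N v * eV F m n N v) (eV F m n N v)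
  | orth (v w : V m n N) (h : v ≠ w) : PARel F m n N (eV F m n N v * eV F m n N w) 0
  | src (a : E m n N) :
      PARel F m n N (eV F m n N a.1.1 * arE F m n N a) (arE F m n N a)
  | tgt (a : E m n N) :
      PARel F m n N (arE F m n N a * eV F m n N a.1.2) (arE F m n N a)
  | srcZero (v : V m n N) (a : E m n N) (h : v ≠ a.1.1) :
      PARel F m n N (eV F m n N v * arE F m n N a) 0
  | tgtZero (a : E m n N) (v : V m n N) (h : v ≠ a.1.2) :
      PARel F m n N (arE F m n N a * eV F m n N v) 0
  | unit : PARel F m n N (∑ᶠ v : V m n N, eV F m n N v) 1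

/-- The coefficient `c_κ^μ(λ)` where `λ = s_D(κ)` with `D = (d1,d2)`, and
`μ = s_C(λ)` with `C = (i,j)` a circle of `λ`. -/
noncomputable def cCoef {N : ℕ} (ka : Wt N) (d1 d2 i j : Fin N) : ℤ :=
  if IsCircle ka i j then
    if Encloses i j d1 d2 then
      (-1) ^ ({p : Fin N × Fin N |
        IsCircle ka p.1 p.2 ∧ Encloses p.1 p.2 d1 d2 ∧ Encloses i j p.1 p.2}.ncard) * 2
    else 0
  else 1

/-- Generator of type (A): the sum of all length-2 paths from `la` to `mu`. -/
noncomputable def GenA (F : Type*) [Field F] (m n N : ℕ) (la mu : Wt N) : FA F m n N :=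
  ∑ᶠ nu : Wt N, arW F m n N la nu * arW F m n N nu mu

/-- Generator of type (D): `ȳ_λ^μ x̄_λ^μ + Σ_κ c_κ^μ(λ) x̄_κ^λ ȳ_κ^λ`, for `λ` a
weight with circle `C = (i,j)` and `μ = s_C(λ)`. -/
noncomputable def GenD (F : Type*) [Field F] (m n N : ℕ) (la : Wt N) (i j : Fin N) :
    FA F m n N :=
  arW F m n N la (swapC la i j) * arW F m n N (swapC la i j) la +
    ∑ᶠ ka : Wt N, ∑ᶠ d1 : Fin N, ∑ᶠ d2 : Fin N,
      if IsCircle ka d1 d2 ∧ la = swapC ka d1 d2 then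
        cCoef ka d1 d2 i j • (arW F m n N la ka * arW F m n N ka la)
      else 0

/-- The relations presenting `K̄_m^n = kQ̄_m^n / Ī_m^n`: the path-algebra relations
together with the quadratic generators (A)–(D) of the ideal `Ī_m^n`. -/
inductive KbarRel (F : Type*) [Field F] (m n N : ℕ) : FA F m n N → FA F m n N → Prop
  | pa {x y : FA F m n N} : PARel F m n N x y → KbarRel F m n N x y
  | genA (la mu : Wt N) (h1 : IsWeight m n la) (h2 : IsWeight m n mu) (hne : la ≠ mu)
      (htwo : 2 ≤ {nu : Wt N | GammaAdj la nu ∧ GammaAdj nu mu}.ncard) :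
      KbarRel F m n N (GenA F m n N la mu) 0
  | genB1 (la : Wt N) (h : IsWeight m n la) (i j i' j' : Fin N)
      (hC : IsCircle la i j) (hC' : IsCircle la i' j') (henc : Encloses i j i' j')
      (hno : ¬ ∃ a b : Fin N, IsCircle la a b ∧ Encloses a b i' j' ∧ Encloses i j a b) :
      KbarRel F m n N
        (arW F m n N la (swapC la i j) *
          arW F m n N (swapC la i j) (swapC (swapC la i j) i' j')) 0
  | genB2 (la : Wt N) (h : IsWeight m n la) (i j i' j' : Fin N)
      (hC : IsCircle la i j) (hC' : IsCircle la i' j') (henc : Encloses i j i' j')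
      (hno : ¬ ∃ a b : Fin N, IsCircle la a b ∧ Encloses a b i' j' ∧ Encloses i j a b) :
      KbarRel F m n N
        (arW F m n N (swapC (swapC la i j) i' j') (swapC la i j) *
          arW F m n N (swapC la i j) la) 0
  | genC (la mu : Wt N) (h1 : IsWeight m n la) (h2 : IsWeight m n mu) (hne : la ≠ mu)
      (c1 c2 d1 d2 : Fin N) (hC : IsCircle la c1 c2) (hC'' : IsCircle mu d1 d2)
      (hsw : swapC la c1 c2 = swapC mu d1 d2)
      (hcross : (c1 < d1 ∧ d1 < c2 ∧ c2 < d2) ∨ (d1 < c1 ∧ c1 < d2 ∧ d2 < c2)) :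
      KbarRel F m n N
        (arW F m n N la (swapC la c1 c2) * arW F m n N (swapC la c1 c2) mu) 0
  | genD (la : Wt N) (h : IsWeight m n la) (i j : Fin N) (hC : IsCircle la i j) :
      KbarRel F m n N (GenD F m n N la i j) 0

/-- The Koszul dual `K̄_m^n` of the extended Khovanov arc algebra, presented as a
quotient of the free algebra on the vertices and arrows of `Q̄_m^n`. -/
abbrev Kbar (F : Type*) [Field F] (m n N : ℕ) := RingQuot (KbarRel F m n N)

/-- The canonical projection; an element of the path algebra lies in the ideal
`Ī_m^n` if and only if its image under this map is zero. -/
noncomputable def toKbar (F : Type*) [Field F] (m n N : ℕ) :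
    FA F m n N →ₐ[F] Kbar F m n N :=
  RingQuot.mkAlgHom F (KbarRel F m n N)

/-- The degree-`i` component of `K̄_m^n` (image of the span of the length-`i` paths). -/
noncomputable def degComp (F : Type*) [Field F] (m n N : ℕ) (i : ℕ) :
    Submodule F (Kbar F m n N) :=
  Submodule.span F {x : Kbar F m n N | ∃ p : List (Wt N),
    p.length = i + 1 ∧ (∀ v ∈ p, IsWeight m n v) ∧ p.Chain' GammaAdj ∧
    x = toKbar F m n N (pathEl F m n N p)}

/-- The linear map `x ↦ e_λ x e_μ` on `K̄_m^n`. -/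
noncomputable def sandwich (F : Type*) [Field F] (m n N : ℕ) (la mu : Wt N) :
    Kbar F m n N →ₗ[F] Kbar F m n N :=
  (LinearMap.mulLeft F (toKbar F m n N (eW F m n N la))).comp
    (LinearMap.mulRight F (toKbar F m n N (eW F m n N mu)))

end Kh

namespace Kh

/-- Triples of weights: a length-2 path through `u, v, w` is encoded by the triple
`(u, v, w)`, and the degree-2 components of both `kQ_m^n` and `kQ̄_m^n` are the span
of the basis vectors `single t 1` over path triples `t` inside `T3 N →₀ F`. -/
abbrev T3 (N : ℕ) := Wt N × Wt N × Wt N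

/-- Reversal of a triple, implementing the correspondence `a₁a₂ ↦ b̄₂b̄₁` between
length-2 paths of `Q_m^n` and of `Q̄_m^n`. -/
def rev3 {N : ℕ} (t : T3 N) : T3 N := (t.2.2, t.2.1, t.1)

/-- `(u,v,w)` encodes a length-2 path (in `Q_m^n` or equivalently in `Q̄_m^n`). -/
def IsPathTriple {N : ℕ} (m n : ℕ) (t : T3 N) : Prop :=
  IsWeight m n t.1 ∧ IsWeight m n t.2.1 ∧ IsWeight m n t.2.2 ∧
    GammaAdj t.1 t.2.1 ∧ GammaAdj t.2.1 t.2.2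

/-- The degree-2 component: the span of the length-2 paths. -/
noncomputable def Deg2 (F : Type*) [Field F] (m n N : ℕ) :
    Submodule F (T3 N →₀ F) :=
  Submodule.span F {f : T3 N →₀ F | ∃ t : T3 N, IsPathTriple m n t ∧
    f = Finsupp.single t 1}

/-- The quadratic generators (i)–(iii) of the ideal `I_m^n` of `kQ_m^n`, as elements
of the degree-2 component.  (In `Q_m^n`, `x` is the ascending and `y` the descending
arrow, so e.g. `x_λ^ν x_ν^{s_{(j,p)}(ν)}` is the triple `(λ, ν, s_{(j,p)}(ν))`.) -/
def GensI (F : Type*) [Field F] (m n N : ℕ) : Set (T3 N →₀ F) :=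
  {f | (∃ (la : Wt N) (i j p : Fin N), IsWeight m n la ∧ IsCircle la i j ∧
          Unmatched la p ∧
          ((la p = false ∧ j < p ∧ IsCircle (swapC la i j) j p ∧
            (f = Finsupp.single (la, swapC la i j, swapC (swapC la i j) j p) 1 ∨
             f = Finsupp.single (swapC (swapC la i j) j p, swapC la i j, la) 1)) ∨
           (la p = true ∧ p < i ∧ IsCircle (swapC la i j) p i ∧
            (f = Finsupp.single (la, swapC la i j, swapC (swapC la i j) p i) 1 ∨
             f = Finsupp.single (swapC (swapC la i j) p i, swapC la i j, la) 1)))) ∨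
       (∃ la mu nu nu' : Wt N, IsWeight m n la ∧ IsWeight m n mu ∧ la ≠ mu ∧
          GammaAdj la nu ∧ GammaAdj nu mu ∧ GammaAdj la nu' ∧ GammaAdj nu' mu ∧
          f = Finsupp.single (la, nu, mu) 1 - Finsupp.single (la, nu', mu) 1) ∨
       (∃ (la ka : Wt N) (d1 d2 : Fin N), IsWeight m n la ∧ IsCircle ka d1 d2 ∧
          la = swapC ka d1 d2 ∧
          f = Finsupp.single (la, ka, la) 1 -
            ∑ᶠ i : Fin N, ∑ᶠ j : Fin N,
              if IsCircle la i j then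
                cCoef ka d1 d2 i j • Finsupp.single (la, swapC la i j, la) (1 : F)
              else 0)}

/-- The quadratic generators (A)–(D) of the ideal `Ī_m^n` of `kQ̄_m^n`, as elements
of the degree-2 component.  (In `Q̄_m^n`, `ȳ` is the ascending and `x̄` the
descending arrow, so e.g. `ȳ_λ^ν x̄_μ^ν` is the triple `(λ, ν, μ)`.) -/
def GensIbar (F : Type*) [Field F] (m n N : ℕ) : Set (T3 N →₀ F) :=
  {f | (∃ la mu : Wt N, IsWeight m n la ∧ IsWeight m n mu ∧ la ≠ mu ∧
          2 ≤ {nu : Wt N | GammaAdj la nu ∧ GammaAdj nu mu}.ncard ∧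
          f = ∑ᶠ nu : Wt N,
            if GammaAdj la nu ∧ GammaAdj nu mu then
              Finsupp.single (la, nu, mu) (1 : F)
            else 0) ∨
       (∃ (la : Wt N) (i j i' j' : Fin N), IsWeight m n la ∧
          IsCircle la i j ∧ IsCircle la i' j' ∧ Encloses i j i' j' ∧
          (¬ ∃ a b : Fin N, IsCircle la a b ∧ Encloses a b i' j' ∧ Encloses i j a b) ∧
          (f = Finsupp.single (la, swapC la i j, swapC (swapC la i j) i' j') 1 ∨
           f = Finsupp.single (swapC (swapC la i j) i' j', swapC la i j, la) 1)) ∨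
       (∃ (la mu : Wt N) (c1 c2 d1 d2 : Fin N), IsWeight m n la ∧ IsWeight m n mu ∧
          la ≠ mu ∧ IsCircle la c1 c2 ∧ IsCircle mu d1 d2 ∧
          swapC la c1 c2 = swapC mu d1 d2 ∧
          ((c1 < d1 ∧ d1 < c2 ∧ c2 < d2) ∨ (d1 < c1 ∧ c1 < d2 ∧ d2 < c2)) ∧
          f = Finsupp.single (la, swapC la c1 c2, mu) 1) ∨
       (∃ (la : Wt N) (i j : Fin N), IsWeight m n la ∧ IsCircle la i j ∧
          f = Finsupp.single (la, swapC la i j, la) 1 +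
            ∑ᶠ ka : Wt N, ∑ᶠ d1 : Fin N, ∑ᶠ d2 : Fin N,
              if IsCircle ka d1 d2 ∧ la = swapC ka d1 d2 then
                cCoef ka d1 d2 i j • Finsupp.single (la, ka, la) (1 : F)
              else 0)}

end Kh

namespace Kh
variable {N : ℕ}

/-- sign of a bracket -/
def sg (b : Bool) : ℤ := if b then 1 else -1

/-- prefix height -/
def Hh (u : Wt N) (k : ℕ) : ℤ := ∑ t : Fin N, if t.val < k then sg (u t) else 0

/-- the open segment between positions `i`, `j` is a Dyck word -/
def Dy (f : ℕ → ℤ) (i j : ℕ) : Prop :=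
  f j = f (i + 1) ∧ ∀ k, i < k → k ≤ j → f (i + 1) ≤ f k

theorem sg_cases (b : Bool) : (b = true ∧ sg b = 1) ∨ (b = false ∧ sg b = -1) := by
  cases b <;> simp [sg]

theorem Hh_succ (u : Wt N) (q : Fin N) : Hh u (q.val + 1) = Hh u q.val + sg (u q) := by
  unfold Hh
  have : sg (u q) = ∑ t : Fin N, if t = q then sg (u t) else 0 := by simp
  rw [this, ← Finset.sum_add_distrib]
  apply Finset.sum_congr rfl
  intro t _
  by_cases h1 : t = q
  · subst h1; simp
  · have : t.val ≠ q.val := fun h => h1 (Fin.ext h)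
    by_cases h2 : t.val < q.val
    · have h3 : t.val < q.val + 1 := by omega
      simp [h1, h2, h3]
    · have h3 : ¬ t.val < q.val + 1 := by omega
      simp [h1, h2, h3]

theorem Hh_succ_ge (u : Wt N) (k : ℕ) (hk : N ≤ k) : Hh u (k + 1) = Hh u k := by
  unfold Hh
  apply Finset.sum_congr rfl
  intro t _
  have := t.isLt
  have h1 : t.val < k := by omega
  have h2 : t.val < k + 1 := by omega
  simp [h1, h2]

theorem cnt_diff (u : Wt N) (i k : Fin N) (h : i ≤ k) :
    (cnt u true i k : ℤ) - cnt u false i k = Hh u (k.val + 1) - Hh u (i.val + 1) := by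
  have hc : ∀ b, (cnt u b i k : ℤ) = ∑ t : Fin N, if i < t ∧ t ≤ k ∧ u t = b then 1 else 0 := by
    intro b
    unfold cnt
    rw [Set.ncard_eq_toFinset_card']
    simp
  rw [hc, hc]
  unfold Hh
  rw [← Finset.sum_sub_distrib, ← Finset.sum_sub_distrib]
  apply Finset.sum_congr rfl
  intro t _
  have h' : i.val ≤ k.val := h
  simp only [Fin.lt_def, Fin.le_def]
  rcases sg_cases (u t) with ⟨h1, h2⟩ | ⟨h1, h2⟩ <;> rw [h1] at * <;> rw [h2] <;> simp <;>
    split_ifs <;> first | rfl | omega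

theorem isCircle_iff (u : Wt N) (i j : Fin N) :
    IsCircle u i j ↔ i < j ∧ u i = true ∧ u j = false ∧ Dy (Hh u) i.val j.val := by
  unfold IsCircle
  constructor
  · rintro ⟨h1, h2, h3, h4, h5⟩
    refine ⟨h1, h2, h3, ?_, ?_⟩
    · have := cnt_diff u i j h1.le
      have h6 := Hh_succ u j
      rw [h3] at h6
      simp [sg] at h6
      omega
    · intro k hk hk'
      by_cases hki : k = i.val + 1
      · rw [hki]
      · have hj := j.isLt
        have := cnt_diff u i ⟨k - 1, by omega⟩ (by simp [Fin.le_def]; omega)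
        have h7 := h5 ⟨k - 1, by omega⟩ (by simp [Fin.lt_def]; omega) (by simp [Fin.lt_def]; omega)
        simp only [show k - 1 + 1 = k by omega] at this
        omega
  · rintro ⟨h1, h2, h3, h4, h5⟩
    refine ⟨h1, h2, h3, ?_, ?_⟩
    · have := cnt_diff u i j h1.le
      have h6 := Hh_succ u j
      rw [h3] at h6
      simp [sg] at h6
      omega
    · intro k hk hk'
      have := cnt_diff u i k hk.le
      have := h5 (k.val + 1) (by have : i.val < k.val := hk; omega)
        (by have : k.val < j.val := hk'; omega)
      omega

theorem Hh_swap (u : Wt N) (x y : Fin N) (hxy : x < y) (hne : u x ≠ u y) (k : ℕ) :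
    Hh (swapC u x y) k = Hh u k - (if x.val < k ∧ k ≤ y.val then 2 * sg (u x) else 0) := by
  have hxy' : x.val < y.val := hxy
  induction k with
  | zero => simp [Hh]
  | succ k ih =>
    by_cases hk : k < N
    · have e1 := Hh_succ u ⟨k, hk⟩
      have e2 := Hh_succ (swapC u x y) ⟨k, hk⟩
      simp only at e1 e2
      rw [e1, e2, ih]
      have hs : sg (u y) = - sg (u x) := by
        revert hne; cases u x <;> cases u y <;> simp [sg]
      unfold swapC
      by_cases h1 : (⟨k, hk⟩ : Fin N) = x
      · have : x.val = k := by rw [← h1]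
        rw [if_pos h1, hs, h1]
        split_ifs <;> omega
      · by_cases h2 : (⟨k, hk⟩ : Fin N) = y
        · have : y.val = k := by rw [← h2]
          rw [if_neg h1, if_pos h2, h2, hs]
          split_ifs <;> omega
        · have h3 : k ≠ x.val := fun h => h1 (Fin.ext h)
          have h4 : k ≠ y.val := fun h => h2 (Fin.ext h)
          rw [if_neg h1, if_neg h2]
          split_ifs <;> omega
    · have := y.isLt
      rw [Hh_succ_ge _ _ (by omega), Hh_succ_ge _ _ (by omega), ih]
      split_ifs <;> omega

/-- `v` arises from `u` by exchanging the distinct values at `x < y`, the segment between being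
a Dyck word. -/
def Sw (u : Wt N) (x y : Fin N) (v : Wt N) : Prop :=
  x < y ∧ u x ≠ u y ∧ Dy (Hh u) x.val y.val ∧ v = swapC u x y

theorem swap_swap (u : Wt N) (x y : Fin N) : swapC (swapC u x y) x y = u := by
  funext t; unfold swapC; grind

theorem Sw.symm {u v : Wt N} {x y : Fin N} (h : Sw u x y v) : Sw v x y u := by
  obtain ⟨h1, h2, h3, rfl⟩ := h
  have h1' : x.val < y.val := h1
  have hH := Hh_swap u x y h1 h2
  refine ⟨h1, ?_, ?_, (swap_swap u x y).symm⟩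
  · unfold swapC; grind
  · obtain ⟨h4, h5⟩ := h3
    refine ⟨?_, ?_⟩
    · rw [hH, hH]; split_ifs <;> omega
    · intro k hk hk'
      have := h5 k hk hk'
      rw [hH, hH]; split_ifs <;> omega

theorem Sw.of_circle {u : Wt N} {x y : Fin N} (h : IsCircle u x y) : Sw u x y (swapC u x y) := by
  rw [isCircle_iff] at h
  exact ⟨h.1, by rw [h.2.1, h.2.2.1]; simp, h.2.2.2, rfl⟩

theorem Sw.circle {u v : Wt N} {x y : Fin N} (h : Sw u x y v) (hx : u x = true) :
    IsCircle u x y := by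
  rw [isCircle_iff]
  refine ⟨h.1, hx, ?_, h.2.2.1⟩
  have := h.2.1
  rw [hx] at this
  simpa using this.symm

theorem gammaAdj_iff (u v : Wt N) : GammaAdj u v ↔ ∃ x y, Sw u x y v := by
  constructor
  · rintro (⟨i, j, h, rfl⟩ | ⟨i, j, h, rfl⟩)
    · exact ⟨i, j, Sw.of_circle h⟩
    · exact ⟨i, j, (Sw.of_circle h).symm⟩
  · rintro ⟨x, y, h⟩
    cases hx : u x
    · right
      refine ⟨x, y, h.symm.circle ?_, h.symm.2.2.2⟩
      have := h.2.1
      rw [hx] at this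
      rw [h.2.2.2]; simp [swapC]
      simpa using this.symm
    · left
      exact ⟨x, y, h.circle hx, h.2.2.2⟩

theorem gammaAdj_symm {u v : Wt N} (h : GammaAdj u v) : GammaAdj v u := Or.symm h

/-- first return -/
theorem match_right (f : ℕ → ℤ) (hf : ∀ k, f k - 1 ≤ f (k + 1)) (i k : ℕ) (hik : i < k)
    (hk : f k < f (i + 1)) : ∃ c, i < c ∧ c < k ∧ f (c + 1) = f c - 1 ∧ Dy f i c := by
  have hex : ∃ d, i < d ∧ f d < f (i + 1) := ⟨k, hik, hk⟩
  set d := Nat.find hex with hd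
  obtain ⟨h1, h2⟩ := Nat.find_spec hex
  have h3 : ∀ e, i < e → e < d → f (i + 1) ≤ f e := by
    intro e he he'
    have := Nat.find_min hex he'
    by_contra hcon
    exact this ⟨he, by omega⟩
  have h4 : d ≤ k := Nat.find_min' hex ⟨hik, hk⟩
  rw [← hd] at h1 h2
  have h5 : d ≠ i + 1 := by rintro h; rw [h] at h2; omega
  have h6 := h3 (d - 1) (by omega) (by omega)
  have h7 := hf (d - 1)
  rw [show d - 1 + 1 = d by omega] at h7
  refine ⟨d - 1, by omega, by omega, ?_, ?_, ?_⟩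
  · rw [show d - 1 + 1 = d by omega]; omega
  · omega
  · intro e he he'
    exact h3 e he (by omega)

theorem match_left (f : ℕ → ℤ) (hf : ∀ k, f (k + 1) ≤ f k + 1) (k j : ℕ) (hkj : k < j)
    (hk : f k < f j) : ∃ c, k ≤ c ∧ c < j ∧ f (c + 1) = f c + 1 ∧ Dy f c j := by
  -- induct on `j - k`
  obtain ⟨n, hn⟩ : ∃ n, j = k + n := ⟨j - k, by omega⟩
  induction n generalizing k with
  | zero => omega
  | succ n ih =>
    by_cases hex : ∃ e, k < e ∧ e < j ∧ f e < f j
    · -- take the largest such e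
      have : ∀ m, ∀ e, j - e ≤ m → k < e → e < j → f e < f j →
          ∃ c, k ≤ c ∧ c < j ∧ f (c + 1) = f c + 1 ∧ Dy f c j := by
        intro m
        induction m with
        | zero => intro e h1 h2 h3; omega
        | succ m ihm =>
          intro e h1 h2 h3 h4
          by_cases h5 : ∃ e', e < e' ∧ e' < j ∧ f e' < f j
          · obtain ⟨e', h6, h7, h8⟩ := h5
            exact ihm e' (by omega) (by omega) h7 h8
          · have h6 : ∀ e', e < e' → e' ≤ j → f j ≤ f e' := by
              intro e' a b
              by_contra hcon
              rcases Nat.lt_or_ge e' j with h | h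
              · exact h5 ⟨e', a, h, by omega⟩
              · have : e' = j := by omega
                subst this; omega
            have h7 := h6 (e + 1) (by omega) (by omega)
            have h8 := hf e
            refine ⟨e, by omega, h3, by omega, by omega, ?_⟩
            intro e' a b
            have := h6 e' a b
            omega
      obtain ⟨e, h2, h3, h4⟩ := hex
      exact this (j - e) e le_rfl h2 h3 h4
    · have h6 : ∀ e', k < e' → e' ≤ j → f j ≤ f e' := by
        intro e' a b
        by_contra hcon
        rcases Nat.lt_or_ge e' j with h | h
        · exact hex ⟨e', a, h, by omega⟩
        · have : e' = j := by omega
          subst this; omega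
      have h7 := h6 (k + 1) (by omega) (by omega)
      have h8 := hf k
      refine ⟨k, by omega, hkj, by omega, by omega, ?_⟩
      intro e' a b
      have := h6 e' a b
      omega

theorem Hh_step (u : Wt N) (k : ℕ) : Hh u (k + 1) ≤ Hh u k + 1 ∧ Hh u k - 1 ≤ Hh u (k + 1) := by
  by_cases hk : k < N
  · have e1 := Hh_succ u ⟨k, hk⟩
    simp only at e1
    rcases sg_cases (u ⟨k, hk⟩) with ⟨_, h⟩ | ⟨_, h⟩ <;> omega
  · rw [Hh_succ_ge _ _ (by omega)]; omega

/-- comparison of two-step paths: difference sets -/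
theorem classify {l v w : Wt N} {x y z t : Fin N} (h1 : Sw l x y v) (h2 : Sw v z t w)
    (hne : l ≠ w) :
    (x ≠ z ∧ x ≠ t ∧ y ≠ z ∧ y ≠ t ∧ ∀ s, l s ≠ w s ↔ s = x ∨ s = y ∨ s = z ∨ s = t) ∨
    (y = z ∧ ∀ s, l s ≠ w s ↔ s = x ∨ s = t) ∨
    (x = t ∧ ∀ s, l s ≠ w s ↔ s = y ∨ s = z) ∨
    (x = z ∧ y ≠ t ∧ ∀ s, l s ≠ w s ↔ s = y ∨ s = t) ∨
    (y = t ∧ x ≠ z ∧ ∀ s, l s ≠ w s ↔ s = x ∨ s = z) := by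
  obtain ⟨a1, a2, -, rfl⟩ := h1
  obtain ⟨b1, b2, -, rfl⟩ := h2
  by_cases hxz : x = z
  · by_cases hyt : y = t
    · subst hxz hyt
      exact absurd (swap_swap l x y).symm hne
    · right; right; right; left
      refine ⟨hxz, hyt, ?_⟩
      clear hne
      intro s
      unfold swapC at *
      cases hx : l x <;> cases hy : l y <;> cases hz : l z <;> cases ht : l t <;> grind
  · by_cases hyt : y = t
    · right; right; right; right
      refine ⟨hyt, hxz, ?_⟩
      clear hne
      intro s
      unfold swapC at *
      cases hx : l x <;> cases hy : l y <;> cases hz : l z <;> cases ht : l t <;> grind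
    · by_cases hyz : y = z
      · right; left
        refine ⟨hyz, ?_⟩
        clear hne
        intro s
        unfold swapC at *
        cases hx : l x <;> cases hy : l y <;> cases hz : l z <;> cases ht : l t <;> grind
      · by_cases hxt : x = t
        · right; right; left
          refine ⟨hxt, ?_⟩
          clear hne
          intro s
          unfold swapC at *
          cases hx : l x <;> cases hy : l y <;> cases hz : l z <;> cases ht : l t <;> grind
        · left
          refine ⟨hxz, hxt, hyz, hyt, ?_⟩
          clear hne
          intro s
          unfold swapC at *
          cases hx : l x <;> cases hy : l y <;> cases hz : l z <;> cases ht : l t <;> grind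

end Kh

namespace Kh
variable {N : ℕ}

def TI0 (la nu mu : Wt N) : Prop :=
  ∃ i j p : Fin N, IsCircle la i j ∧ Unmatched la p ∧ nu = swapC la i j ∧
    ((la p = false ∧ j < p ∧ IsCircle nu j p ∧ mu = swapC nu j p) ∨
     (la p = true ∧ p < i ∧ IsCircle nu p i ∧ mu = swapC nu p i))

def TB0 (la nu mu : Wt N) : Prop :=
  ∃ i j i' j' : Fin N, IsCircle la i j ∧ IsCircle la i' j' ∧ Encloses i j i' j' ∧
    (¬ ∃ a b : Fin N, IsCircle la a b ∧ Encloses a b i' j' ∧ Encloses i j a b) ∧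
    nu = swapC la i j ∧ mu = swapC nu i' j'

def TC (la nu mu : Wt N) : Prop :=
  ∃ c1 c2 d1 d2 : Fin N, la ≠ mu ∧ IsCircle la c1 c2 ∧ IsCircle mu d1 d2 ∧
    nu = swapC la c1 c2 ∧ nu = swapC mu d1 d2 ∧
    ((c1 < d1 ∧ d1 < c2 ∧ c2 < d2) ∨ (d1 < c1 ∧ c1 < d2 ∧ d2 < c2))

def Alt (l v w : Wt N) : Prop := ∃ v', GammaAdj l v' ∧ GammaAdj v' w ∧ v' ≠ v

theorem Alt.symm {l v w : Wt N} (h : Alt l v w) : Alt w v l := by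
  obtain ⟨v', a, b, c⟩ := h
  exact ⟨v', gammaAdj_symm b, gammaAdj_symm a, c⟩

theorem TC.symm {l v w : Wt N} (h : TC l v w) : TC w v l := by
  obtain ⟨c1, c2, d1, d2, a, b, c, d, e, f⟩ := h
  exact ⟨d1, d2, c1, c2, a.symm, c, b, e, d, f.symm⟩

theorem Alt.mk {l v w v' : Wt N} {x y z t : Fin N} (h1 : Sw l x y v') (h2 : Sw v' z t w)
    (h : v' ≠ v) : Alt l v w :=
  ⟨v', (gammaAdj_iff _ _).2 ⟨x, y, h1⟩, (gammaAdj_iff _ _).2 ⟨z, t, h2⟩, h⟩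

theorem Sw.H {l v : Wt N} {x y : Fin N} (h : Sw l x y v) (k : ℕ) :
    Hh v k = Hh l k - (if x.val < k ∧ k ≤ y.val then 2 * sg (l x) else 0) := by
  rw [h.2.2.2]; exact Hh_swap l x y h.1 h.2.1 k

theorem ne_of_app {u v : Wt N} (x : Fin N) (h : u x ≠ v x) : u ≠ v := fun e => h (by rw [e])

theorem swap_left (u : Wt N) (x y : Fin N) : swapC u x y x = u y := by simp [swapC]
theorem swap_right (u : Wt N) (x y : Fin N) : swapC u x y y = u x := by
  unfold swapC; grind
theorem swap_other (u : Wt N) (x y s : Fin N) (h1 : s ≠ x) (h2 : s ≠ y) :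
    swapC u x y s = u s := by simp [swapC, h1, h2]

theorem commute_alt {l v w : Wt N} {x y z t : Fin N} (h1 : Sw l x y v) (h2 : Sw v z t w)
    (hxz : x ≠ z) (hxt : x ≠ t) (hyz : y ≠ z) (hyt : y ≠ t)
    (d1 : Dy (Hh l) z.val t.val) (d2 : Dy (Hh (swapC l z t)) x.val y.val) : Alt l v w := by
  obtain ⟨a1, a2, -, rfl⟩ := h1
  obtain ⟨b1, b2, -, rfl⟩ := h2
  rw [swap_other _ _ _ _ hxz.symm hyz.symm, swap_other _ _ _ _ hxt.symm hyt.symm] at b2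
  refine Alt.mk (x := z) (y := t) (z := x) (t := y) (v' := swapC l z t) ⟨b1, b2, d1, rfl⟩
    ⟨a1, ?_, d2, ?_⟩ ?_
  · rwa [swap_other _ _ _ _ hxz hxt, swap_other _ _ _ _ hyz hyt]
  · funext s; unfold swapC; grind
  · apply ne_of_app x
    rwa [swap_other _ _ _ _ hxz hxt, swap_left]

theorem sep_alt {l v w : Wt N} {x y z t : Fin N} (h1 : Sw l x y v) (h2 : Sw v z t w)
    (h : y < z ∨ t < x) : Alt l v w := by
  have a1 : x.val < y.val := h1.1
  have b1 : z.val < t.val := h2.1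
  have hH := h1.H
  have h' : y.val < z.val ∨ t.val < x.val := h
  have n1 : x ≠ z := by rintro rfl; omega
  have n2 : x ≠ t := by rintro rfl; omega
  have n3 : y ≠ z := by rintro rfl; omega
  have n4 : y ≠ t := by rintro rfl; omega
  have d1 : Dy (Hh l) z.val t.val := by
    obtain ⟨e, f⟩ := h2.2.2.1
    rw [hH, hH] at e
    refine ⟨by split_ifs at e <;> omega, ?_⟩
    intro k k1 k2
    have := f k k1 k2
    rw [hH, hH] at this
    split_ifs at this <;> omega
  refine commute_alt h1 h2 n1 n2 n3 n4 d1 ?_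
  have hne := h2.2.1
  rw [h1.2.2.2, swap_other _ _ _ _ n1.symm n3.symm, swap_other _ _ _ _ n2.symm n4.symm] at hne
  have hG := Hh_swap l z t h2.1 hne
  obtain ⟨e, f⟩ := h1.2.2.1
  refine ⟨by rw [hG, hG]; split_ifs <;> omega, ?_⟩
  intro k k1 k2
  have := f k k1 k2
  rw [hG, hG]; split_ifs <;> omega

theorem nest_alt {l v w : Wt N} {x y z t : Fin N} (h1 : Sw l x y v) (h2 : Sw v z t w)
    (hx : x < z) (hy : t < y) : Alt l v w ∨ TB0 l v w := by
  have a1 : x.val < y.val := h1.1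
  have b1 : z.val < t.val := h2.1
  have hx' : x.val < z.val := hx
  have hy' : t.val < y.val := hy
  have hH := h1.H
  have n1 : x ≠ z := by rintro rfl; omega
  have n2 : x ≠ t := by rintro rfl; omega
  have n3 : y ≠ z := by rintro rfl; omega
  have n4 : y ≠ t := by rintro rfl; omega
  have d1 : Dy (Hh l) z.val t.val := by
    obtain ⟨e, f⟩ := h2.2.2.1
    rw [hH, hH] at e
    refine ⟨by split_ifs at e <;> omega, ?_⟩
    intro k k1 k2
    have := f k k1 k2
    rw [hH, hH] at this
    split_ifs at this <;> omega
  have hne := h2.2.1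
  rw [h1.2.2.2, swap_other _ _ _ _ n1.symm n3.symm, swap_other _ _ _ _ n2.symm n4.symm] at hne
  have hG := Hh_swap l z t h2.1 hne
  obtain ⟨e, f⟩ := h1.2.2.1
  obtain ⟨e', f'⟩ := d1
  have sz := Hh_succ l z
  have st := Hh_succ l t
  have sx := Hh_succ l x
  cases hz : l z
  · left
    refine commute_alt h1 h2 n1 n2 n3 n4 ⟨e', f'⟩ ?_
    rw [hz] at hG
    simp [sg] at hG
    refine ⟨by rw [hG, hG]; split_ifs <;> omega, ?_⟩
    intro k k1 k2
    have := f k k1 k2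
    rw [hG, hG]; split_ifs <;> omega
  · have ht : l t = false := by rw [hz] at hne; simpa using hne.symm
    rw [hz] at hG sz
    rw [ht] at st
    simp [sg] at hG sz st
    have fz := f z.val hx' (by omega)
    by_cases hlt : Hh l (x.val + 1) < Hh l z.val
    · left
      refine commute_alt h1 h2 n1 n2 n3 n4 ⟨e', f'⟩ ?_
      refine ⟨by rw [hG, hG]; split_ifs <;> omega, ?_⟩
      intro k k1 k2
      have := f k k1 k2
      have := f' k
      rw [hG, hG]; split_ifs <;> omega
    · cases hlx : l x
      · left
        have hly : l y = true := by have := h1.2.1; rw [hlx] at this; simpa using this.symm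
        have hnxz : l x ≠ l z := by simp [hlx, hz]
        have hK := Hh_swap l x z hx hnxz
        refine Alt.mk (v' := swapC l x z) (x := x) (y := z) (z := t) (t := y)
          ⟨hx, hnxz, ⟨by omega, fun k k1 k2 => f k k1 (by omega)⟩, rfl⟩
          ⟨hy, ?_, ⟨?_, ?_⟩, ?_⟩ ?_
        · rw [swap_other _ _ _ _ n2.symm h2.1.ne', swap_other _ _ _ _ h1.1.ne' n3, hly, ht]
          simp
        · rw [hK, hK]; split_ifs <;> omega
        · intro k k1 k2
          have := f k (by omega) k2
          rw [hK, hK]; split_ifs <;> omega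
        · rw [h2.2.2.2, h1.2.2.2]
          have := h2.1.ne
          have := h1.1.ne
          funext s; unfold swapC; grind
        · apply ne_of_app y
          rw [swap_other _ _ _ _ h1.1.ne' n3, h1.2.2.2, swap_right, hly, hlx]
          simp
      · right
        refine ⟨x, y, z, t, h1.circle hlx, ?_, ⟨hx, hy⟩, ?_, h1.2.2.2, h2.2.2.2⟩
        · rw [isCircle_iff]; exact ⟨h2.1, hz, ht, e', f'⟩
        · rintro ⟨a, b, hab, ⟨c1, c2⟩, ⟨c3, c4⟩⟩
          rw [isCircle_iff] at hab
          obtain ⟨g1, g2, g3, g4, g5⟩ := hab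
          have sa := Hh_succ l a
          rw [g2] at sa
          simp [sg] at sa
          have c1' : a.val < z.val := c1
          have c2' : t.val < b.val := c2
          have c3' : x.val < a.val := c3
          have := g5 z.val c1' (by omega)
          have := f a.val (by omega) (by omega)
          omega

theorem cross_TC {l v w : Wt N} {x y z t : Fin N} (hlw : l ≠ w) (h1 : Sw l x y v) (h2 : Sw v z t w)
    (hx : x < z) (hzy : z < y) (hy : y < t) : TC l v w := by
  have hx' : x.val < z.val := hx
  have hz' : z.val < y.val := hzy
  have hy' : y.val < t.val := hy
  have hH := h1.H
  obtain ⟨e, f⟩ := h1.2.2.1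
  obtain ⟨e', f'⟩ := h2.2.2.1
  have sz := Hh_succ l z
  have sy := Hh_succ l y
  have q1 := f z.val (by omega) (by omega)
  have q2 := f (z.val + 1) (by omega) (by omega)
  have q3 := f' y.val (by omega) (by omega)
  have q4 := f' (y.val + 1) (by omega) (by omega)
  rw [hH, hH] at q3 q4
  rw [if_pos (by omega), if_pos (by omega)] at q3
  rw [if_pos (by omega), if_neg (by omega)] at q4
  have hne := h1.2.1
  rcases sg_cases (l x) with ⟨r1, r2⟩ | ⟨r1, r2⟩ <;> rcases sg_cases (l y) with ⟨r3, r4⟩ | ⟨r3, r4⟩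
    <;> rcases sg_cases (l z) with ⟨r5, r6⟩ | ⟨r5, r6⟩
    <;> rw [r1, r3] at hne <;> simp at hne <;> try omega
  have hvz : v z = false := by
    rw [h1.2.2.2, swap_other _ _ _ _ hx.ne' hzy.ne, r5]
  have hvt : v t = true := by
    have := h2.2.1
    rw [hvz] at this; simpa using this.symm
  refine ⟨x, y, z, t, hlw, h1.circle r1, h2.symm.circle ?_, h1.2.2.2, h2.symm.2.2.2, Or.inl ⟨hx, hzy, hy⟩⟩
  rw [h2.2.2.2, swap_left, hvt]

theorem left_alt {l v w : Wt N} {x y t : Fin N} (h1 : Sw l x y v) (h2 : Sw v x t w)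
    (hy : y < t) : Alt l v w := by
  have a1 : x.val < y.val := h1.1
  have hy' : y.val < t.val := hy
  have hH := h1.symm.H
  obtain ⟨e, f⟩ := h1.symm.2.2.1
  obtain ⟨e', f'⟩ := h2.2.2.1
  have sy := Hh_succ v y
  have q1 := f' (y.val + 1) (by omega) (by omega)
  have hvy : v y = true := by
    rcases sg_cases (v y) with ⟨r1, r2⟩ | ⟨r1, r2⟩
    · exact r1
    · omega
  have hvx : v x = false := by
    have := h1.symm.2.1; rw [hvy] at this; simpa using this
  have hvt : v t = true := by
    have := h2.2.1; rw [hvx] at this; simpa using this.symm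
  rw [hvy] at sy
  simp [sg] at sy
  obtain ⟨c0, c1, c2, c3, c4⟩ := match_right (Hh v) (fun k => (Hh_step v k).2) y.val t.val hy'
    (by omega)
  have := t.isLt
  obtain ⟨c, rfl⟩ : ∃ c : Fin N, c.val = c0 := ⟨⟨c0, by omega⟩, rfl⟩
  have sc := Hh_succ v c
  have hvc : v c = false := by
    rcases sg_cases (v c) with ⟨r1, r2⟩ | ⟨r1, r2⟩
    · omega
    · exact r1
  have hyc : y < c := c1
  have hct : c < t := c2
  have hxc : x < c := h1.1.trans hyc
  have hlv := h1.symm.2.2.2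
  have hlc : l c = false := by rw [hlv, swap_other _ _ _ _ hxc.ne' hyc.ne', hvc]
  have hlt : l t = true := by rw [hlv, swap_other _ _ _ _ h2.1.ne' hy.ne', hvt]
  have hly : l y = false := by rw [hlv, swap_right, hvx]
  have hne : l c ≠ l t := by simp [hlc, hlt]
  have hK := Hh_swap l c t hct hne
  refine Alt.mk (v' := swapC l c t) (x := c) (y := t) (z := y) (t := c)
    ⟨hct, hne, ⟨?_, ?_⟩, rfl⟩ ⟨hyc, ?_, ⟨?_, ?_⟩, ?_⟩ ?_
  · obtain ⟨c4, c5⟩ := c4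
    rw [hH, hH]; split_ifs <;> omega
  · obtain ⟨c4, c5⟩ := c4
    intro k k1 k2
    have := f' k (by omega) k2
    rw [hH, hH]; split_ifs <;> omega
  · rw [swap_left, swap_other _ _ _ _ hyc.ne hy.ne, hly, hlt]; simp
  · obtain ⟨c4, c5⟩ := c4
    rw [hK, hK, hH, hH]; split_ifs <;> omega
  · obtain ⟨c4, c5⟩ := c4
    intro k k1 k2
    have := c5 k k1 k2
    rw [hK, hK, hH, hH]; split_ifs <;> omega
  · rw [h2.2.2.2, hlv]
    have := h1.1.ne
    have := h2.1.ne
    funext s; unfold swapC; grind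
  · apply ne_of_app x
    have hlx : l x = true := by rw [hlv, swap_left, hvy]
    rw [swap_other _ _ _ _ hxc.ne h2.1.ne, hvx, hlx]; simp

theorem right_alt {l v w : Wt N} {x y z : Fin N} (h1 : Sw l x y v) (h2 : Sw v z y w)
    (hz : z < x) : Alt l v w := by
  have a1 : x.val < y.val := h1.1
  have hz' : z.val < x.val := hz
  have hH := h1.symm.H
  obtain ⟨e, f⟩ := h1.symm.2.2.1
  obtain ⟨e', f'⟩ := h2.2.2.1
  have sx := Hh_succ v x
  have sz := Hh_succ v z
  have q1 := f' x.val (by omega) (by omega)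
  have hvx : v x = false := by
    rcases sg_cases (v x) with ⟨r1, r2⟩ | ⟨r1, r2⟩
    · omega
    · exact r1
  have hvy : v y = true := by
    have := h1.symm.2.1; rw [hvx] at this; simpa using this.symm
  have hvz : v z = false := by
    have := h2.2.1; rw [hvy] at this; simpa using this
  rw [hvx] at sx
  simp [sg] at sx
  have hne0 : z.val + 1 ≠ x.val := by
    intro h; rw [h] at e'; omega
  obtain ⟨c0, c1, c2, c3, c4⟩ := match_left (Hh v) (fun k => (Hh_step v k).1) (z.val + 1) x.val
    (by omega) (by omega)
  have := x.isLt
  obtain ⟨c, rfl⟩ : ∃ c : Fin N, c.val = c0 := ⟨⟨c0, by omega⟩, rfl⟩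
  have sc := Hh_succ v c
  have hvc : v c = true := by
    rcases sg_cases (v c) with ⟨r1, r2⟩ | ⟨r1, r2⟩
    · exact r1
    · omega
  have hzc : z < c := by have : z.val < c.val := by omega
                         exact this
  have hcx : c < x := c2
  have hcy : c < y := hcx.trans h1.1
  have hlv := h1.symm.2.2.2
  have hlc : l c = true := by rw [hlv, swap_other _ _ _ _ hcx.ne hcy.ne, hvc]
  have hlz : l z = false := by rw [hlv, swap_other _ _ _ _ hz.ne h2.1.ne, hvz]
  have hlx : l x = true := by rw [hlv, swap_left, hvy]
  have hly : l y = false := by rw [hlv, swap_right, hvx]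
  have hne : l z ≠ l c := by simp [hlc, hlz]
  have hK := Hh_swap l z c hzc hne
  obtain ⟨c4, c5⟩ := c4
  refine Alt.mk (v' := swapC l z c) (x := z) (y := c) (z := c) (t := x)
    ⟨hzc, hne, ⟨?_, ?_⟩, rfl⟩ ⟨hcx, ?_, ⟨?_, ?_⟩, ?_⟩ ?_
  · rw [hH, hH]; split_ifs <;> omega
  · intro k k1 k2
    have := f' k (by omega) (by omega)
    rw [hH, hH]; split_ifs <;> omega
  · rw [swap_right, swap_other _ _ _ _ hz.ne' hcx.ne', hlx, hlz]; simp
  · rw [hK, hK, hH, hH]; split_ifs <;> omega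
  · intro k k1 k2
    have := c5 k k1 k2
    rw [hK, hK, hH, hH]; split_ifs <;> omega
  · rw [h2.2.2.2, hlv]
    have := h1.1.ne
    have := h2.1.ne
    funext s; unfold swapC; grind
  · apply ne_of_app y
    rw [swap_other _ _ _ _ h2.1.ne' hcy.ne', hvy, hly]; simp

end Kh

namespace Kh
variable {N : ℕ}

theorem mid_alt {l v w : Wt N} {x y t : Fin N} (h1 : Sw l x y v) (h2 : Sw v y t w) :
    Alt l v w ∨ TI0 l v w ∨ TI0 w v l := by
  have a1 : x.val < y.val := h1.1
  have b1 : y.val < t.val := h2.1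
  have hxt : x < t := h1.1.trans h2.1
  cases hlx : l x
  · -- `w` is the lower one
    have hly : l y = true := by have := h1.2.1; rw [hlx] at this; simpa using this.symm
    have hvx : v x = true := by rw [h1.2.2.2, swap_left, hly]
    have hvy : v y = false := by rw [h1.2.2.2, swap_right, hlx]
    have hvt : v t = true := by have := h2.2.1; rw [hvy] at this; simpa using this.symm
    have hwt : w t = false := by rw [h2.2.2.2, swap_right, hvy]
    have hwy : w y = true := by rw [h2.2.2.2, swap_left, hvt]
    have hwx : w x = true := by rw [h2.2.2.2, swap_other _ _ _ _ h1.1.ne hxt.ne, hvx]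
    by_cases hun : Unmatched w x
    · right; right
      exact ⟨y, t, x, h2.symm.circle hwy, hun, h2.symm.2.2.2, Or.inr ⟨hwx, h1.1,
        h1.symm.circle hvx, h1.symm.2.2.2⟩⟩
    · left
      apply Alt.symm
      have hV := h2.symm.H
      rw [hwy] at hV
      simp only [sg, if_true] at hV
      obtain ⟨e, f⟩ := h1.symm.2.2.1
      obtain ⟨e', f'⟩ := h2.symm.2.2.1
      have sx := Hh_succ w x
      have sy := Hh_succ w y
      have st := Hh_succ w t
      rw [hwx] at sx
      rw [hwy] at sy
      rw [hwt] at st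
      simp [sg] at sx sy st
      rw [hV, hV, if_neg (by omega), if_neg (by omega)] at e
      have g : ∀ k, x.val < k → k ≤ y.val → Hh w (x.val + 1) ≤ Hh w k := by
        intro k k1 k2
        have := f k k1 k2
        rw [hV, hV, if_neg (by omega), if_neg (by omega)] at this
        omega
      unfold Unmatched at hun
      push Not at hun
      obtain ⟨q, hq⟩ := hun
      have hq' : IsCircle w x q := by
        by_contra hcon
        have := hq hcon
        rw [isCircle_iff, hwx] at this
        simp at this
      rw [isCircle_iff] at hq'
      obtain ⟨p1, p2, p3, p4, p5⟩ := hq'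
      have sq := Hh_succ w q
      rw [p3] at sq
      simp [sg] at sq
      have p1' : x.val < q.val := p1
      have hqy : q.val ≠ y.val := by intro h; have := Fin.ext h; subst this; simp_all
      have hqt : t.val < q.val := by
        by_contra hcon
        have r1 := g (q.val + 1)
        have r2 := f' q.val
        omega
      have hqt' : t < q := hqt
      have hne : w x ≠ w q := by simp [hwx, p3]
      have hK := Hh_swap w x q p1 hne
      rw [hwx] at hK
      simp only [sg, if_true] at hK
      refine Alt.mk (v' := swapC w x q) (x := x) (y := q) (z := t) (t := q)
        ⟨p1, hne, ⟨p4, p5⟩, rfl⟩ ⟨hqt', ?_, ⟨?_, ?_⟩, ?_⟩ ?_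
      · rw [swap_right, swap_other _ _ _ _ hxt.ne' hqt'.ne, hwx, hwt]; simp
      · rw [hK, hK]; split_ifs <;> omega
      · intro k k1 k2
        have := p5 k (by omega) k2
        rw [hK, hK]; split_ifs <;> omega
      · rw [h1.symm.2.2.2, h2.symm.2.2.2]
        have := h1.1.ne
        have := h2.1.ne
        have := hqt'.ne
        have := p1.ne
        funext s; unfold swapC; grind
      · apply ne_of_app q
        rw [swap_right, hwx, h2.symm.2.2.2, swap_other _ _ _ _ (h2.1.trans hqt').ne' hqt'.ne', p3]
        simp
  · have hly : l y = false := by have := h1.2.1; rw [hlx] at this; simpa using this.symm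
    have hvx : v x = false := by rw [h1.2.2.2, swap_left, hly]
    have hvy : v y = true := by rw [h1.2.2.2, swap_right, hlx]
    have hvt : v t = false := by have := h2.2.1; rw [hvy] at this; simpa using this.symm
    have hlt : l t = false := by
      rw [h1.symm.2.2.2, swap_other _ _ _ _ hxt.ne' h2.1.ne', hvt]
    by_cases hun : Unmatched l t
    · right; left
      exact ⟨x, y, t, h1.circle hlx, hun, h1.2.2.2, Or.inl ⟨hlt, h2.1,
        h2.circle hvy, h2.2.2.2⟩⟩
    · left
      have hV := h1.H
      rw [hlx] at hV
      simp only [sg, if_true] at hV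
      obtain ⟨e, f⟩ := h1.2.2.1
      obtain ⟨e', f'⟩ := h2.2.2.1
      have sx := Hh_succ l x
      have sy := Hh_succ l y
      have st := Hh_succ l t
      rw [hlx] at sx
      rw [hly] at sy
      rw [hlt] at st
      simp [sg] at sx sy st
      rw [hV, hV, if_neg (by omega), if_neg (by omega)] at e'
      have g : ∀ k, y.val < k → k ≤ t.val → Hh l (y.val + 1) ≤ Hh l k := by
        intro k k1 k2
        have := f' k k1 k2
        rw [hV, hV, if_neg (by omega), if_neg (by omega)] at this
        omega
      unfold Unmatched at hun
      push Not at hun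
      obtain ⟨q, hq⟩ := hun
      have hq' : IsCircle l q t := by
        apply hq
        rw [isCircle_iff, hlt]
        simp
      rw [isCircle_iff] at hq'
      obtain ⟨p1, p2, p3, p4, p5⟩ := hq'
      have sq := Hh_succ l q
      rw [p2] at sq
      simp [sg] at sq
      have p1' : q.val < t.val := p1
      have hqy : q.val ≠ y.val := by intro h; have := Fin.ext h; subst this; simp_all
      have hqx : q.val < x.val := by
        by_contra hcon
        have r0 := p5 (y.val + 1)
        have r1 := f q.val
        have r2 := g q.val
        by_cases hxq : q.val = x.val
        · rw [hxq] at r0; omega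
        · omega
      have hqx' : q < x := hqx
      have hne : l q ≠ l t := by simp [hlt, p2]
      have hK := Hh_swap l q t p1 hne
      rw [p2] at hK
      simp only [sg, if_true] at hK
      refine Alt.mk (v' := swapC l q t) (x := q) (y := t) (z := q) (t := x)
        ⟨p1, hne, ⟨p4, p5⟩, rfl⟩ ⟨hqx', ?_, ⟨?_, ?_⟩, ?_⟩ ?_
      · rw [swap_left, swap_other _ _ _ _ hqx'.ne' hxt.ne, hlx, hlt]; simp
      · rw [hK, hK]; split_ifs <;> omega
      · intro k k1 k2
        have := p5 k (by omega) (by omega)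
        rw [hK, hK]; split_ifs <;> omega
      · rw [h2.2.2.2, h1.2.2.2]
        have := h1.1.ne
        have := h2.1.ne
        have := hqx'.ne
        have := p1.ne
        funext s; unfold swapC; grind
      · apply ne_of_app q
        rw [swap_left, hlt, h1.2.2.2, swap_other _ _ _ _ hqx'.ne (hqx'.trans h1.1).ne, p2]
        simp

def TI (l v w : Wt N) : Prop := TI0 l v w ∨ TI0 w v l
def TB (l v w : Wt N) : Prop := TB0 l v w ∨ TB0 w v l

/-- T4 -/
theorem exists_alt {l v w : Wt N} (hlw : l ≠ w) (h1 : GammaAdj l v) (h2 : GammaAdj v w) :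
    Alt l v w ∨ TI l v w ∨ TB l v w ∨ TC l v w := by
  obtain ⟨x, y, h1⟩ := (gammaAdj_iff _ _).1 h1
  obtain ⟨z, t, h2⟩ := (gammaAdj_iff _ _).1 h2
  have hxy := h1.1
  have hzt := h2.1
  rcases classify h1 h2 hlw with ⟨n1, n2, n3, n4, -⟩ | ⟨rfl, -⟩ | ⟨rfl, -⟩ | ⟨rfl, n, -⟩ |
    ⟨rfl, n, -⟩
  · have : (y < z ∨ t < x) ∨ (x < z ∧ t < y) ∨ (z < x ∧ y < t) ∨ (x < z ∧ z < y ∧ y < t) ∨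
      (z < x ∧ x < t ∧ t < y) := by
      have := fun h => n1 (Fin.ext h)
      have := fun h => n2 (Fin.ext h)
      have := fun h => n3 (Fin.ext h)
      have := fun h => n4 (Fin.ext h)
      simp only [Fin.lt_def] at *
      omega
    rcases this with h | ⟨ha, hb⟩ | ⟨ha, hb⟩ | ⟨ha, hb, hc⟩ | ⟨ha, hb, hc⟩
    · exact Or.inl (sep_alt h1 h2 h)
    · rcases nest_alt h1 h2 ha hb with h | h
      · exact Or.inl h
      · exact Or.inr (Or.inr (Or.inl (Or.inl h)))
    · rcases nest_alt h2.symm h1.symm ha hb with h | h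
      · exact Or.inl h.symm
      · exact Or.inr (Or.inr (Or.inl (Or.inr h)))
    · exact Or.inr (Or.inr (Or.inr (cross_TC hlw h1 h2 ha hb hc)))
    · exact Or.inr (Or.inr (Or.inr (cross_TC hlw.symm h2.symm h1.symm ha hb hc).symm))
  · rcases mid_alt h1 h2 with h | h
    · exact Or.inl h
    · exact Or.inr (Or.inl h)
  · rcases mid_alt h2.symm h1.symm with h | h
    · exact Or.inl h.symm
    · exact Or.inr (Or.inl h.symm)
  · rcases lt_or_gt_of_ne n with h | h
    · exact Or.inl (left_alt h1 h2 h)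
    · exact Or.inl (left_alt h2.symm h1.symm h).symm
  · rcases lt_or_gt_of_ne n with h | h
    · exact Or.inl (right_alt h2.symm h1.symm h).symm
    · exact Or.inl (right_alt h1 h2 h)

end Kh

namespace Kh
variable {N : ℕ}

theorem six {q1 q2 q3 q4 x y z t : Fin N} (h1 : q1 < q2) (h2 : q2 < q3) (h3 : q3 < q4)
    (hxy : x < y) (hzt : z < t) (n1 : x ≠ z) (n2 : x ≠ t) (n3 : y ≠ z) (n4 : y ≠ t)
    (h : ∀ s, (s = q1 ∨ s = q2 ∨ s = q3 ∨ s = q4) ↔ (s = x ∨ s = y ∨ s = z ∨ s = t)) :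
    (x = q1 ∧ y = q2 ∧ z = q3 ∧ t = q4) ∨ (x = q3 ∧ y = q4 ∧ z = q1 ∧ t = q2) ∨
    (x = q1 ∧ y = q3 ∧ z = q2 ∧ t = q4) ∨ (x = q2 ∧ y = q4 ∧ z = q1 ∧ t = q3) ∨
    (x = q1 ∧ y = q4 ∧ z = q2 ∧ t = q3) ∨ (x = q2 ∧ y = q3 ∧ z = q1 ∧ t = q4) := by
  have e1 := (h x).2 (by simp)
  have e2 := (h y).2 (by simp)
  have e3 := (h z).2 (by simp)
  have e4 := (h t).2 (by simp)
  clear h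
  have l1 : q1 < q3 := h1.trans h2
  have l2 : q2 < q4 := h2.trans h3
  have l3 : q1 < q4 := h1.trans l2
  rcases e1 with rfl | rfl | rfl | rfl <;> rcases e2 with rfl | rfl | rfl | rfl <;>
    first
    | exact (lt_irrefl _ hxy).elim
    | exact (lt_asymm hxy ‹_›).elim
    | (rcases e3 with rfl | rfl | rfl | rfl <;>
        first
        | exact (n1 rfl).elim
        | exact (n3 rfl).elim
        | (rcases e4 with rfl | rfl | rfl | rfl <;>
            first
            | exact (n2 rfl).elim
            | exact (n4 rfl).elim
            | exact (lt_irrefl _ hzt).elim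
            | exact (lt_asymm hzt ‹_›).elim
            | simp))

theorem four_not_two {q1 q2 q3 q4 a b : Fin N} (h1 : q1 < q2) (h2 : q2 < q3) (_h3 : q3 < q4)
    (h : ∀ s, (s = q1 ∨ s = q2 ∨ s = q3 ∨ s = q4) ↔ (s = a ∨ s = b)) : False := by
  have e1 := (h q1).1 (by simp)
  have e2 := (h q2).1 (by simp)
  have e3 := (h q3).1 (by simp)
  clear h
  simp only [Fin.ext_iff, Fin.lt_def] at *
  omega

/-- all middle vertices, for a difference set with four elements -/
theorem four_paths {l w v' : Wt N} {q1 q2 q3 q4 : Fin N} (h1 : q1 < q2) (h2 : q2 < q3)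
    (h3 : q3 < q4) (hd : ∀ s, l s ≠ w s ↔ (s = q1 ∨ s = q2 ∨ s = q3 ∨ s = q4))
    (g1 : GammaAdj l v') (g2 : GammaAdj v' w) :
    (Sw l q1 q2 v' ∧ Sw v' q3 q4 w) ∨ (Sw l q3 q4 v' ∧ Sw v' q1 q2 w) ∨
    (Sw l q1 q3 v' ∧ Sw v' q2 q4 w) ∨ (Sw l q2 q4 v' ∧ Sw v' q1 q3 w) ∨
    (Sw l q1 q4 v' ∧ Sw v' q2 q3 w) ∨ (Sw l q2 q3 v' ∧ Sw v' q1 q4 w) := by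
  have hlw : l ≠ w := ne_of_app q1 ((hd q1).2 (by simp))
  obtain ⟨x, y, g1⟩ := (gammaAdj_iff _ _).1 g1
  obtain ⟨z, t, g2⟩ := (gammaAdj_iff _ _).1 g2
  rcases classify g1 g2 hlw with ⟨n1, n2, n3, n4, hh⟩ | ⟨-, hh⟩ | ⟨-, hh⟩ | ⟨-, -, hh⟩ |
    ⟨-, -, hh⟩
  · have := six h1 h2 h3 g1.1 g2.1 n1 n2 n3 n4 (fun s => (hd s).symm.trans (hh s))
    rcases this with ⟨rfl, rfl, rfl, rfl⟩ | ⟨rfl, rfl, rfl, rfl⟩ | ⟨rfl, rfl, rfl, rfl⟩ |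
      ⟨rfl, rfl, rfl, rfl⟩ | ⟨rfl, rfl, rfl, rfl⟩ | ⟨rfl, rfl, rfl, rfl⟩ <;> simp [g1, g2]
  all_goals exact (four_not_two h1 h2 h3 (fun s => (hd s).symm.trans (hh s))).elim

theorem diff_four {l v w : Wt N} {x y z t : Fin N} (h1 : Sw l x y v) (h2 : Sw v z t w)
    (n1 : x ≠ z) (n2 : x ≠ t) (n3 : y ≠ z) (n4 : y ≠ t) :
    ∀ s, l s ≠ w s ↔ s = x ∨ s = y ∨ s = z ∨ s = t := by
  have hlw : l ≠ w := by
    apply ne_of_app x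
    rw [h2.2.2.2, swap_other _ _ _ _ n1 n2, h1.2.2.2, swap_left]
    exact h1.2.1
  rcases classify h1 h2 hlw with ⟨-, -, -, -, h⟩ | ⟨h, -⟩ | ⟨h, -⟩ | ⟨h, -⟩ | ⟨h, -⟩
  · exact h
  · exact absurd h n3
  · exact absurd h n2
  · exact absurd h n1
  · exact absurd h n4

/-- structure of `TB0` -/
theorem TB0.data {l v w : Wt N} (h : TB0 l v w) : ∃ q1 q2 q3 q4 : Fin N, q1 < q2 ∧ q2 < q3 ∧
    q3 < q4 ∧ l q1 = true ∧ l q2 = true ∧ l q3 = false ∧ l q4 = false ∧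
    Sw l q1 q4 v ∧ Sw v q2 q3 w ∧ Dy (Hh l) q2.val q3.val ∧ Hh l q2.val = Hh l (q1.val + 1) := by
  obtain ⟨q1, q4, q2, q3, c1, c2, ⟨e1, e2⟩, hno, rfl, rfl⟩ := h
  have hS := Sw.of_circle c1
  have hS2 := Sw.of_circle c2
  have o1 : q1.val < q2.val := e1
  have o2 : q2.val < q3.val := hS2.1
  have o3 : q3.val < q4.val := e2
  have c1' := (isCircle_iff _ _ _).1 c1
  have c2' := (isCircle_iff _ _ _).1 c2
  obtain ⟨-, a1, a2, a3, a4⟩ := c1'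
  obtain ⟨-, b1, b2, b3, b4⟩ := c2'
  have hH := hS.H
  refine ⟨q1, q2, q3, q4, e1, hS2.1, e2, a1, b1, b2, a2, hS, ⟨hS2.1, ?_, ⟨?_, ?_⟩, rfl⟩,
    ⟨b3, b4⟩, ?_⟩
  · rw [swap_other _ _ _ _ e1.ne' (hS2.1.trans e2).ne, swap_other _ _ _ _ (e1.trans hS2.1).ne' e2.ne,
      b1, b2]; simp
  · rw [hH, hH]; split_ifs <;> omega
  · intro k k1 k2
    have := b4 k k1 k2
    rw [hH, hH]; split_ifs <;> omega
  · by_contra hcon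
    have m1 := a4 q2.val o1 (by omega)
    have s2 := Hh_succ l q2
    have s3 := Hh_succ l q3
    rw [b1] at s2
    rw [b2] at s3
    simp [sg] at s2 s3
    have hne : q1.val + 1 ≠ q2.val := by intro h; rw [h] at hcon; exact hcon rfl
    obtain ⟨c0, d1, d2, d3, d4, d5⟩ := match_left (Hh l) (fun k => (Hh_step l k).1) (q1.val + 1)
      q2.val (by omega) (by omega)
    obtain ⟨b0, f1, f2, f3, f4, f5⟩ := match_right (Hh l) (fun k => (Hh_step l k).2) c0 q4.val
      (by omega) (by omega)
    have := q4.isLt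
    obtain ⟨c, rfl⟩ : ∃ c : Fin N, c.val = c0 := ⟨⟨c0, by omega⟩, rfl⟩
    obtain ⟨b, rfl⟩ : ∃ c : Fin N, c.val = b0 := ⟨⟨b0, by omega⟩, rfl⟩
    have sc := Hh_succ l c
    have sb := Hh_succ l b
    have hc : l c = true := by
      rcases sg_cases (l c) with ⟨r1, r2⟩ | ⟨r1, r2⟩
      · exact r1
      · omega
    have hb : l b = false := by
      rcases sg_cases (l b) with ⟨r1, r2⟩ | ⟨r1, r2⟩
      · omega
      · exact r1
    refine hno ⟨c, b, (isCircle_iff _ _ _).2 ⟨f1, hc, hb, f4, f5⟩, ⟨d2, ?_⟩, ⟨?_, f2⟩⟩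
    · show q3.val < b.val
      by_contra hcon2
      have r1 := d5 (b.val + 1)
      have r2 := b4 (b.val + 1)
      have r3 : b.val = q3.val → False := by
        intro h; rw [h] at f4; omega
      have r4 : b.val = q2.val → False := by
        intro h; rw [h] at f3; omega
      rcases lt_trichotomy b.val q2.val with h | h | h
      · have := r1 (by omega) (by omega); omega
      · exact r4 h
      · by_cases h' : b.val = q3.val
        · exact r3 h'
        · have := r2 (by omega) (by omega); omega
    · show q1.val < c.val
      omega

theorem TB0.uniq {l v w v' : Wt N} (h : TB0 l v w) (g1 : GammaAdj l v') (g2 : GammaAdj v' w) :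
    v' = v := by
  obtain ⟨q1, q2, q3, q4, o1, o2, o3, r1, r2, r3, r4, h1, h2, ⟨h3, h4⟩, h5⟩ := h.data
  have hd := diff_four h1 h2 o1.ne (o1.trans o2).ne (o2.trans o3).ne' o3.ne'
  have o1' : q1.val < q2.val := o1
  have o2' : q2.val < q3.val := o2
  have o3' : q3.val < q4.val := o3
  have s2 := Hh_succ l q2
  have s3 := Hh_succ l q3
  rw [r2] at s2
  rw [r3] at s3
  simp [sg] at s2 s3
  rcases four_paths o1 o2 o3 (fun s => (hd s).trans (by tauto)) g1 g2 with ⟨k1, k2⟩ | ⟨k1, k2⟩ |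
    ⟨k1, k2⟩ | ⟨k1, k2⟩ | ⟨k1, k2⟩ | ⟨k1, k2⟩
  · exact absurd (r1.trans r2.symm) k1.2.1
  · exact absurd (r3.trans r4.symm) k1.2.1
  · have := k1.2.2.1.1; omega
  · have := k1.2.2.1.2 (q3.val + 1) (by omega) (by omega); omega
  · rw [k1.2.2.2, h1.2.2.2]
  · have hH := k1.H
    have := k2.2.2.1.2 (q2.val + 1) (by omega) (by omega)
    rw [hH, hH, if_neg (by omega), if_pos (by omega), r2] at this
    simp [sg] at this
    omega

theorem TB0.adj {l v w : Wt N} (h : TB0 l v w) : GammaAdj l v ∧ GammaAdj v w ∧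
    ∃ q1 q2 q3 : Fin N, q1 ≠ q2 ∧ q1 ≠ q3 ∧ q2 ≠ q3 ∧ l q1 ≠ w q1 ∧ l q2 ≠ w q2 ∧ l q3 ≠ w q3 := by
  obtain ⟨q1, q2, q3, q4, o1, o2, o3, r1, r2, r3, r4, h1, h2, ⟨h3, h4⟩, h5⟩ := h.data
  have hd := diff_four h1 h2 o1.ne (o1.trans o2).ne (o2.trans o3).ne' o3.ne'
  exact ⟨(gammaAdj_iff _ _).2 ⟨_, _, h1⟩, (gammaAdj_iff _ _).2 ⟨_, _, h2⟩, q1, q2, q3, o1.ne,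
    (o1.trans o2).ne, o2.ne, (hd _).2 (by simp), (hd _).2 (by simp), (hd _).2 (by simp)⟩

theorem cross_uniq {l v w v' : Wt N} {q1 q2 q3 q4 : Fin N} (c1 : IsCircle l q1 q3)
    (c2 : IsCircle w q2 q4) (e1 : v = swapC l q1 q3) (e2 : v = swapC w q2 q4)
    (o1 : q1 < q2) (o2 : q2 < q3) (o3 : q3 < q4)
    (g1 : GammaAdj l v') (g2 : GammaAdj v' w) : v' = v := by
  have h1 := Sw.of_circle c1
  have h2 := (Sw.of_circle c2).symm
  rw [← e1] at h1
  rw [← e2] at h2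
  have hd := diff_four h1 h2 o1.ne (o1.trans (o2.trans o3)).ne o2.ne' o3.ne
  have o1' : q1.val < q2.val := o1
  have o2' : q2.val < q3.val := o2
  have o3' : q3.val < q4.val := o3
  obtain ⟨-, r1, r3, d1, d2⟩ := (isCircle_iff _ _ _).1 c1
  obtain ⟨-, w2, w4, -⟩ := (isCircle_iff _ _ _).1 c2
  have r2 : l q2 = false := by
    rw [h1.symm.2.2.2, swap_other _ _ _ _ o1.ne' o2.ne, e2, swap_left, w4]
  have r4 : l q4 = true := by
    rw [h1.symm.2.2.2, swap_other _ _ _ _ (o1.trans (o2.trans o3)).ne' o3.ne', e2, swap_right, w2]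
  obtain ⟨d3, d4⟩ := h2.2.2.1
  have hH := h1.H
  rw [r1] at hH
  simp only [sg, if_true] at hH
  have s2 := Hh_succ l q2
  have s3 := Hh_succ l q3
  rw [r2] at s2
  rw [r3] at s3
  simp [sg] at s2 s3
  have m1 := d2 (q2.val + 1) (by omega) (by omega)
  have m2 := d4 q3.val (by omega) (by omega)
  rw [hH, hH, if_pos (by omega), if_pos (by omega)] at m2
  rcases four_paths o1 o2 o3 (fun s => (hd s).trans (by tauto)) g1 g2 with ⟨k1, k2⟩ | ⟨k1, k2⟩ |
    ⟨k1, k2⟩ | ⟨k1, k2⟩ | ⟨k1, k2⟩ | ⟨k1, k2⟩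
  · have := k1.2.2.1.1; omega
  · have hK := k1.H
    have := k2.2.2.1.1
    rw [hK, hK, if_neg (by omega), if_neg (by omega)] at this
    omega
  · rw [k1.2.2.2, h1.2.2.2]
  · have := k1.2.2.1.2 (q3.val + 1) (by omega) (by omega); omega
  · exact absurd (r1.trans r4.symm) k1.2.1
  · exact absurd (r2.trans r3.symm) k1.2.1

theorem TC.uniq {l v w v' : Wt N} (h : TC l v w) (g1 : GammaAdj l v') (g2 : GammaAdj v' w) :
    v' = v := by
  obtain ⟨c1, c2, d1, d2, -, a, b, c, d, h | h⟩ := h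
  · exact cross_uniq a b c d h.1 h.2.1 h.2.2 g1 g2
  · exact cross_uniq b a d c h.1 h.2.1 h.2.2 (gammaAdj_symm g2) (gammaAdj_symm g1)

theorem TC.adj {l v w : Wt N} (h : TC l v w) : GammaAdj l v ∧ GammaAdj v w ∧
    ∃ q1 q2 q3 : Fin N, q1 ≠ q2 ∧ q1 ≠ q3 ∧ q2 ≠ q3 ∧ l q1 ≠ w q1 ∧ l q2 ≠ w q2 ∧ l q3 ≠ w q3 := by
  obtain ⟨c1, c2, d1, d2, hlw, a, b, c, d, h⟩ := h
  have h1 := Sw.of_circle a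
  have h2 := (Sw.of_circle b).symm
  rw [← c] at h1
  rw [← d] at h2
  have n : c1 ≠ d1 ∧ c1 ≠ d2 ∧ c2 ≠ d1 ∧ c2 ≠ d2 := by
    have := h1.1
    have := h2.1
    simp only [Fin.ext_iff, Fin.lt_def, ne_eq] at *
    omega
  obtain ⟨n1, n2, n3, n4⟩ := n
  have hd := diff_four h1 h2 n1 n2 n3 n4
  exact ⟨(gammaAdj_iff _ _).2 ⟨_, _, h1⟩, (gammaAdj_iff _ _).2 ⟨_, _, h2⟩, c1, c2, d1, h1.1.ne,
    n1, n3, (hd _).2 (by simp), (hd _).2 (by simp), (hd _).2 (by simp)⟩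

end Kh

namespace Kh
variable {N : ℕ}

theorem pair_cases {a b x t : Fin N} (hxt : x < t)
    (h : ∀ s, (s = x ∨ s = t) ↔ (s = a ∨ s = b)) : (a = x ∧ b = t) ∨ (a = t ∧ b = x) := by
  have e1 := (h x).1 (by simp)
  have e2 := (h t).1 (by simp)
  rcases e1 with e1 | e1 <;> rcases e2 with e2 | e2
  · exact absurd (e1.trans e2.symm) hxt.ne
  · exact Or.inl ⟨e1.symm, e2.symm⟩
  · exact Or.inr ⟨e2.symm, e1.symm⟩
  · exact absurd (e1.trans e2.symm) hxt.ne

theorem two_not_four {a b c d x t : Fin N} (n0 : a ≠ b) (n1 : a ≠ c) (n3 : b ≠ c)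
    (h : ∀ s, (s = x ∨ s = t) ↔ (s = a ∨ s = b ∨ s = c ∨ s = d)) : False := by
  have e1 := (h a).2 (by simp)
  have e2 := (h b).2 (by simp)
  have e3 := (h c).2 (by simp)
  grind

/-- data for the first kind of `TI0` -/
theorem TI0.diff {l v w : Wt N} (h : TI0 l v w) : GammaAdj l v ∧ GammaAdj v w ∧
    ∃ a b : Fin N, a < b ∧ ∀ s, l s ≠ w s ↔ s = a ∨ s = b := by
  obtain ⟨i, j, p, c1, un, rfl, h | h⟩ := h
  · obtain ⟨h1, h2, c2, rfl⟩ := h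
    have g1 := Sw.of_circle c1
    have g2 := Sw.of_circle c2
    refine ⟨(gammaAdj_iff _ _).2 ⟨_, _, g1⟩, (gammaAdj_iff _ _).2 ⟨_, _, g2⟩, i, p, g1.1.trans h2, ?_⟩
    have o := g1.1
    have := c1.2.1
    have := c1.2.2.1
    intro s; unfold swapC; grind
  · obtain ⟨h1, h2, c2, rfl⟩ := h
    have g1 := Sw.of_circle c1
    have g2 := Sw.of_circle c2
    refine ⟨(gammaAdj_iff _ _).2 ⟨_, _, g1⟩, (gammaAdj_iff _ _).2 ⟨_, _, g2⟩, p, j, h2.trans g1.1, ?_⟩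
    have o := g1.1
    have := c1.2.1
    have := c1.2.2.1
    intro s; unfold swapC; grind

theorem bool_other {a b : Bool} (h : a ≠ b) (hb : b = false) : a = true := by
  cases a <;> simp_all

theorem bool_other' {a b : Bool} (h : a ≠ b) (hb : b = true) : a = false := by
  cases a <;> simp_all

theorem TI0.uniq1 {l w v' : Wt N} {x y t : Fin N} (c1 : IsCircle l x y) (un : Unmatched l t)
    (lt : l t = false) (yt : y < t) (c2 : IsCircle (swapC l x y) y t)
    (hw : ∀ s, l s ≠ w s ↔ s = x ∨ s = t)
    (g1 : GammaAdj l v') (g2 : GammaAdj v' w) : v' = swapC l x y := by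
  obtain ⟨a, b, g1⟩ := (gammaAdj_iff _ _).1 g1
  obtain ⟨c, d, g2⟩ := (gammaAdj_iff _ _).1 g2
  have hlw : l ≠ w := ne_of_app x ((hw x).2 (by simp))
  have hS := Sw.of_circle c1
  have hH := hS.H
  obtain ⟨o1, lx, ly, p1, p2⟩ := (isCircle_iff _ _ _).1 c1
  obtain ⟨-, -, -, r1, r2⟩ := (isCircle_iff _ _ _).1 c2
  have o1' : x.val < y.val := o1
  have o2' : y.val < t.val := yt
  have sx := Hh_succ l x
  have sy := Hh_succ l y
  rw [lx] at sx
  rw [ly] at sy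
  simp only [sg, if_true] at sx sy
  simp at sy
  have gab : a.val < b.val := g1.1
  have gcd : c.val < d.val := g2.1
  rcases classify g1 g2 hlw with ⟨n1, n2, n3, n4, hh⟩ | ⟨e, hh⟩ | ⟨e, hh⟩ | ⟨e, -, hh⟩ |
    ⟨e, -, hh⟩
  · exact (two_not_four g1.1.ne n1 n3 (fun s => (hw s).symm.trans (hh s))).elim
  all_goals have pc := pair_cases (o1.trans yt) (fun s => (hw s).symm.trans (hh s))
  · subst e
    rcases pc with ⟨rfl, rfl⟩ | ⟨rfl, rfl⟩
    swap
    · omega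
    have lb : l b = false := bool_other' g1.2.1.symm lx
    have sb := Hh_succ l b
    rw [lb] at sb
    simp [sg] at sb
    have k := g1.2.2.1
    have k1 := k.1
    have : b = y := by
      apply Fin.ext
      rcases lt_trichotomy b.val y.val with h | h | h
      · have := p2 (b.val + 1) (by omega) (by omega); omega
      · exact h
      · have := k.2 (y.val + 1) (by omega) (by omega); omega
    subst this
    exact g1.2.2.2
  · subst e
    rcases pc with ⟨rfl, rfl⟩ | ⟨rfl, rfl⟩
    · omega
    · exact ((un a).2 (g1.circle (bool_other g1.2.1 lt))).elim
  · subst e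
    rcases pc with ⟨rfl, rfl⟩ | ⟨rfl, rfl⟩
    · have la : l a = false := bool_other' g1.2.1 lx
      have k := g1.2.2.1.1
      have q := g2.2.2.1.2 (b.val + 1) (by omega) (by omega)
      rw [g1.H, g1.H, if_pos (by omega), if_neg (by omega), la] at q
      simp [sg] at q
      omega
    · exact ((un a).2 (g1.circle (bool_other g1.2.1 lt))).elim
  · subst e
    rcases pc with ⟨rfl, rfl⟩ | ⟨rfl, rfl⟩
    · have := g1.2.2.1.2 (y.val + 1) (by omega) (by omega); omega
    · have q := g2.2.2.1.2 (y.val + 1) (by omega) (by omega)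
      rw [g1.H, g1.H, if_neg (by omega), if_neg (by omega)] at q
      omega

theorem TI0.uniq2 {l w v' : Wt N} {p i j : Fin N} (c1 : IsCircle l i j) (un : Unmatched l p)
    (lp : l p = true) (pi : p < i) (c2 : IsCircle (swapC l i j) p i)
    (hw : ∀ s, l s ≠ w s ↔ s = p ∨ s = j)
    (g1 : GammaAdj l v') (g2 : GammaAdj v' w) : v' = swapC l i j := by
  obtain ⟨a, b, g1⟩ := (gammaAdj_iff _ _).1 g1
  obtain ⟨c, d, g2⟩ := (gammaAdj_iff _ _).1 g2
  have hlw : l ≠ w := ne_of_app p ((hw p).2 (by simp))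
  have hS := Sw.of_circle c1
  have hH := hS.H
  obtain ⟨o1, lx, ly, p1, p2⟩ := (isCircle_iff _ _ _).1 c1
  obtain ⟨-, -, -, r1, r2⟩ := (isCircle_iff _ _ _).1 c2
  have o1' : i.val < j.val := o1
  have o2' : p.val < i.val := pi
  rw [hH, hH, if_neg (by omega), if_neg (by omega)] at r1
  have sx := Hh_succ l i
  have sy := Hh_succ l j
  rw [lx] at sx
  rw [ly] at sy
  simp only [sg, if_true] at sx sy
  simp at sy
  have gab : a.val < b.val := g1.1
  have gcd : c.val < d.val := g2.1
  rcases classify g1 g2 hlw with ⟨n1, n2, n3, n4, hh⟩ | ⟨e, hh⟩ | ⟨e, hh⟩ | ⟨e, -, hh⟩ |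
    ⟨e, -, hh⟩
  · exact (two_not_four g1.1.ne n1 n3 (fun s => (hw s).symm.trans (hh s))).elim
  all_goals have pc := pair_cases (pi.trans o1) (fun s => (hw s).symm.trans (hh s))
  · subst e
    rcases pc with ⟨rfl, rfl⟩ | ⟨rfl, rfl⟩
    · exact ((un b).1 (g1.circle lp)).elim
    · omega
  · subst e
    rcases pc with ⟨rfl, rfl⟩ | ⟨rfl, rfl⟩
    · omega
    have lb : l a = true := bool_other g1.2.1 ly
    have sb := Hh_succ l a
    rw [lb] at sb
    simp [sg] at sb
    have k := g1.2.2.1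
    have k1 := k.1
    have : a = i := by
      apply Fin.ext
      rcases lt_trichotomy a.val i.val with h | h | h
      · have := k.2 i.val (by omega) (by omega); omega
      · exact h
      · have := p2 a.val (by omega) (by omega); omega
    subst this
    exact g1.2.2.2
  · subst e
    rcases pc with ⟨rfl, rfl⟩ | ⟨rfl, rfl⟩
    · have q := g2.2.2.1.1
      have q' := g2.2.2.1.2 i.val (by omega) (by omega)
      rw [g1.H d.val, if_neg (by omega)] at q
      rw [g1.H i.val, if_neg (by omega)] at q'
      omega
    · have := g1.2.2.1.1
      have := g1.2.2.1.2 i.val (by omega) (by omega); omega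
  · subst e
    rcases pc with ⟨rfl, rfl⟩ | ⟨rfl, rfl⟩
    · exact ((un b).1 (g1.circle lp)).elim
    · have k := g1.2.2.1.1
      have q := g2.2.2.1.1
      rw [g1.H, g1.H, if_pos (by omega), if_neg (by omega), ly] at q
      simp [sg] at q
      omega

theorem TI0.uniq {l v w v' : Wt N} (h : TI0 l v w) (g1 : GammaAdj l v') (g2 : GammaAdj v' w) :
    v' = v := by
  obtain ⟨i, j, p, c1, un, rfl, h | h⟩ := h
  · obtain ⟨h1, h2, c2, rfl⟩ := h
    refine TI0.uniq1 c1 un h1 h2 c2 ?_ g1 g2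
    have o := c1.1
    have := c1.2.1
    have := c1.2.2.1
    intro s; unfold swapC; grind
  · obtain ⟨h1, h2, c2, rfl⟩ := h
    refine TI0.uniq2 c1 un h1 h2 c2 ?_ g1 g2
    have o := c1.1
    have := c1.2.1
    have := c1.2.2.1
    intro s; unfold swapC; grind

theorem TI.uniq {l v w v' : Wt N} (h : TI l v w) (g1 : GammaAdj l v') (g2 : GammaAdj v' w) :
    v' = v := by
  rcases h with h | h
  · exact h.uniq g1 g2
  · exact h.uniq (gammaAdj_symm g2) (gammaAdj_symm g1)

theorem TB.uniq {l v w v' : Wt N} (h : TB l v w) (g1 : GammaAdj l v') (g2 : GammaAdj v' w) :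
    v' = v := by
  rcases h with h | h
  · exact h.uniq g1 g2
  · exact h.uniq (gammaAdj_symm g2) (gammaAdj_symm g1)

theorem TI.adj {l v w : Wt N} (h : TI l v w) : GammaAdj l v ∧ GammaAdj v w ∧
    ∃ a b : Fin N, a < b ∧ ∀ s, l s ≠ w s ↔ s = a ∨ s = b := by
  rcases h with h | h
  · exact h.diff
  · obtain ⟨a, b, c⟩ := h.diff
    obtain ⟨x, y, hxy, c⟩ := c
    exact ⟨gammaAdj_symm b, gammaAdj_symm a, x, y, hxy, fun s => ne_comm.trans (c s)⟩

theorem TI.ne {l v w : Wt N} (h : TI l v w) : l ≠ w := by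
  obtain ⟨-, -, a, b, -, c⟩ := h.adj
  exact ne_of_app a ((c a).2 (by simp))

theorem TB.adj {l v w : Wt N} (h : TB l v w) : GammaAdj l v ∧ GammaAdj v w ∧
    ∃ q1 q2 q3 : Fin N, q1 ≠ q2 ∧ q1 ≠ q3 ∧ q2 ≠ q3 ∧ l q1 ≠ w q1 ∧ l q2 ≠ w q2 ∧ l q3 ≠ w q3 := by
  rcases h with h | h
  · exact h.adj
  · obtain ⟨a, b, x, y, z, c1, c2, c3, c4, c5, c6⟩ := h.adj
    exact ⟨gammaAdj_symm b, gammaAdj_symm a, x, y, z, c1, c2, c3, c4.symm, c5.symm, c6.symm⟩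

theorem TI.not_three {l v v' w : Wt N} (h : TI l v w)
    (h' : GammaAdj l v' ∧ GammaAdj v' w ∧
    ∃ q1 q2 q3 : Fin N, q1 ≠ q2 ∧ q1 ≠ q3 ∧ q2 ≠ q3 ∧ l q1 ≠ w q1 ∧ l q2 ≠ w q2 ∧ l q3 ≠ w q3) :
    False := by
  obtain ⟨-, -, a, b, -, c⟩ := h.adj
  obtain ⟨-, -, x, y, z, c1, c2, c3, c4, c5, c6⟩ := h'
  have := (c _).1 c4
  have := (c _).1 c5
  have := (c _).1 c6
  grind

/-- injectivity of swaps -/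
theorem Sw.inj {l v : Wt N} {x y x' y' : Fin N} (h : Sw l x y v) (h' : Sw l x' y' v) :
    x = x' ∧ y = y' := by
  have e : ∀ s, l s ≠ v s ↔ s = x ∨ s = y := by
    intro s
    obtain ⟨h1, h2, -, rfl⟩ := h
    unfold swapC; grind
  have e' : ∀ s, l s ≠ v s ↔ s = x' ∨ s = y' := by
    intro s
    obtain ⟨h1, h2, -, rfl⟩ := h'
    unfold swapC; grind
  rcases pair_cases h.1 (fun s => (e s).symm.trans (e' s)) with ⟨a, b⟩ | ⟨a, b⟩
  · exact ⟨a.symm, b.symm⟩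
  · have := h.1
    have := h'.1
    subst a b
    exact absurd h.1 (lt_asymm h'.1)

theorem circle_inj {l : Wt N} {x y x' y' : Fin N} (h : IsCircle l x y) (h' : IsCircle l x' y')
    (e : swapC l x y = swapC l x' y') : x = x' ∧ y = y' := by
  have h1 := Sw.of_circle h
  rw [e] at h1
  exact h1.inj (Sw.of_circle h')

theorem up_down {l ka : Wt N} {x y x' y' : Fin N} (h : IsCircle l x y) (h' : IsCircle ka x' y')
    (e : l = swapC ka x' y') (e' : ka = swapC l x y) : False := by
  have h1 := Sw.of_circle h
  have h2 := (Sw.of_circle h').symm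
  rw [← e'] at h1
  rw [← e] at h2
  obtain ⟨rfl, rfl⟩ := h1.inj h2
  have a := h.2.1
  have b := h'.2.2.1
  rw [e, swap_left, b] at a
  cases a

theorem down_inj {l ka : Wt N} {x y x' y' : Fin N} (h : IsCircle ka x y) (h' : IsCircle ka x' y')
    (e : l = swapC ka x y) (e' : l = swapC ka x' y') : x = x' ∧ y = y' :=
  circle_inj h h' (e.symm.trans e')

end Kh

namespace Kh
variable {N : ℕ}

/-- orthogonality conditions -/
def Orth (F : Type*) [Field F] (m n N : ℕ) (p : T3 N →₀ F) : Prop :=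
  (∀ l v w : Wt N, TI0 l v w → IsWeight m n l → p (l, v, w) = 0 ∧ p (w, v, l) = 0) ∧
  (∀ la mu nu nu' : Wt N, IsWeight m n la → IsWeight m n mu → la ≠ mu →
    GammaAdj la nu → GammaAdj nu mu → GammaAdj la nu' → GammaAdj nu' mu →
    p (mu, nu, la) = p (mu, nu', la)) ∧
  (∀ (la ka : Wt N) (d1 d2 : Fin N), IsWeight m n la → IsCircle ka d1 d2 →
    la = swapC ka d1 d2 → p (la, ka, la) = ∑ i : Fin N, ∑ j : Fin N,
      if IsCircle la i j then (cCoef ka d1 d2 i j : F) * p (la, swapC la i j, la) else 0)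

/-- pairing with `p` -/
noncomputable def pr {F : Type*} [Field F] (p : T3 N →₀ F) : (T3 N →₀ F) →ₗ[F] F :=
  Finsupp.linearCombination F (fun t => p (rev3 t))

theorem pr_single {F : Type*} [Field F] (p : T3 N →₀ F) (a b c : Wt N) (x : F) :
    pr p (Finsupp.single (a, b, c) x) = x * p (c, b, a) := by
  simp [pr, Finsupp.linearCombination_single, rev3]

theorem pr_eq {F : Type*} [Field F] (p r : T3 N →₀ F) :
    (∑ᶠ t : T3 N, r t * p (rev3 t)) = pr p r := by
  rw [finsum_eq_sum_of_fintype, pr, Finsupp.linearCombination_apply, Finsupp.sum_fintype]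
  · simp
  · simp

theorem pr_rel {F : Type*} [Field F] (p : T3 N →₀ F) (la ka : Wt N) (d1 d2 : Fin N) :
    pr p (Finsupp.single (la, ka, la) 1 -
            ∑ᶠ i : Fin N, ∑ᶠ j : Fin N,
              if IsCircle la i j then
                cCoef ka d1 d2 i j • Finsupp.single (la, swapC la i j, la) (1 : F)
              else 0) = p (la, ka, la) - ∑ i : Fin N, ∑ j : Fin N,
      if IsCircle la i j then (cCoef ka d1 d2 i j : F) * p (la, swapC la i j, la) else 0 := by
  simp only [finsum_eq_sum_of_fintype, map_sub, map_sum, pr_single, one_mul]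
  congr 1
  refine Finset.sum_congr rfl fun i _ => Finset.sum_congr rfl fun j _ => ?_
  split_ifs
  · rw [map_zsmul, pr_single, one_mul, zsmul_eq_mul]
  · simp

theorem orth_iff (F : Type*) [Field F] (m n N : ℕ) (p : T3 N →₀ F) :
    (∀ r ∈ Submodule.span F (GensI F m n N), (∑ᶠ t : T3 N, r t * p (rev3 t)) = 0) ↔
      Orth F m n N p := by
  have h1 : (∀ r ∈ Submodule.span F (GensI F m n N), (∑ᶠ t : T3 N, r t * p (rev3 t)) = 0) ↔
      ∀ r ∈ GensI F m n N, pr p r = 0 := by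
    simp only [pr_eq]
    constructor
    · intro h r hr
      exact h r (Submodule.subset_span hr)
    · intro h r hr
      have : Submodule.span F (GensI F m n N) ≤ LinearMap.ker (pr p) := by
        rw [Submodule.span_le]
        intro x hx
        exact h x hx
      exact this hr
  rw [h1]
  constructor
  · intro h
    refine ⟨?_, ?_, ?_⟩
    · rintro l v w ⟨i, j, q, c1, un, rfl, ⟨a, b, c, rfl⟩ | ⟨a, b, c, rfl⟩⟩ hl
      · constructor
        · have := h _ (Or.inl ⟨l, i, j, q, hl, c1, un, Or.inl ⟨a, b, c, Or.inr rfl⟩⟩)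
          rwa [pr_single, one_mul] at this
        · have := h _ (Or.inl ⟨l, i, j, q, hl, c1, un, Or.inl ⟨a, b, c, Or.inl rfl⟩⟩)
          rwa [pr_single, one_mul] at this
      · constructor
        · have := h _ (Or.inl ⟨l, i, j, q, hl, c1, un, Or.inr ⟨a, b, c, Or.inr rfl⟩⟩)
          rwa [pr_single, one_mul] at this
        · have := h _ (Or.inl ⟨l, i, j, q, hl, c1, un, Or.inr ⟨a, b, c, Or.inl rfl⟩⟩)
          rwa [pr_single, one_mul] at this
    · intro la mu nu nu' w1 w2 hne a b c d
      have := h _ (Or.inr (Or.inl ⟨la, mu, nu, nu', w1, w2, hne, a, b, c, d, rfl⟩))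
      rw [map_sub, pr_single, pr_single, one_mul, one_mul] at this
      exact sub_eq_zero.1 this
    · intro la ka d1 d2 w c e
      have := h _ (Or.inr (Or.inr ⟨la, ka, d1, d2, w, c, e, rfl⟩))
      rw [pr_rel] at this
      exact sub_eq_zero.1 this
  · rintro ⟨h1, h2, h3⟩ r (⟨la, i, j, q, hl, c1, un, ⟨a, b, c, h⟩ | ⟨a, b, c, h⟩⟩ |
      ⟨la, mu, nu, nu', w1, w2, hne, a, b, c, d, rfl⟩ | ⟨la, ka, d1, d2, w, c, e, rfl⟩)
    · have := h1 _ _ _ ⟨i, j, q, c1, un, rfl, Or.inl ⟨a, b, c, rfl⟩⟩ hl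
      rcases h with rfl | rfl
      · rw [pr_single, one_mul]; exact this.2
      · rw [pr_single, one_mul]; exact this.1
    · have := h1 _ _ _ ⟨i, j, q, c1, un, rfl, Or.inr ⟨a, b, c, rfl⟩⟩ hl
      rcases h with rfl | rfl
      · rw [pr_single, one_mul]; exact this.2
      · rw [pr_single, one_mul]; exact this.1
    · rw [map_sub, pr_single, pr_single, one_mul, one_mul, sub_eq_zero]
      exact h2 _ _ _ _ w1 w2 hne a b c d
    · rw [pr_rel, sub_eq_zero]
      exact h3 _ _ _ _ w c e

/-- generator (A) -/
noncomputable def gA (F : Type*) [Field F] (la mu : Wt N) : T3 N →₀ F :=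
  ∑ᶠ nu : Wt N, if GammaAdj la nu ∧ GammaAdj nu mu then Finsupp.single (la, nu, mu) (1 : F) else 0

/-- generator (D) -/
noncomputable def gD (F : Type*) [Field F] (la : Wt N) (i j : Fin N) : T3 N →₀ F :=
  Finsupp.single (la, swapC la i j, la) 1 +
            ∑ᶠ ka : Wt N, ∑ᶠ d1 : Fin N, ∑ᶠ d2 : Fin N,
              if IsCircle ka d1 d2 ∧ la = swapC ka d1 d2 then
                cCoef ka d1 d2 i j • Finsupp.single (la, ka, la) (1 : F)
              else 0

theorem gA_apply (F : Type*) [Field F] (la mu a b c : Wt N) :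
    gA F la mu (a, b, c) = if la = a ∧ mu = c ∧ GammaAdj a b ∧ GammaAdj b c then 1 else 0 := by
  unfold gA
  rw [finsum_eq_sum_of_fintype, Finsupp.finsetSum_apply, Finset.sum_eq_single b]
  · by_cases h : GammaAdj la b ∧ GammaAdj b mu
    · rw [if_pos h, Finsupp.single_apply]
      congr 1
      simp only [Prod.mk.injEq, true_and, eq_iff_iff]
      constructor
      · rintro ⟨rfl, rfl⟩; exact ⟨rfl, rfl, h⟩
      · rintro ⟨rfl, rfl, -⟩; exact ⟨rfl, rfl⟩
    · rw [if_neg h, if_neg]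
      · rfl
      · rintro ⟨rfl, rfl, h'⟩; exact h h'
  · intro b' _ hb
    split_ifs
    · rw [Finsupp.single_apply, if_neg]
      simp [hb]
    · rfl
  · simp

theorem gD_apply (F : Type*) [Field F] (la a b c : Wt N) (i j : Fin N) :
    gD F la i j (a, b, c) = (if la = a ∧ la = c ∧ swapC la i j = b then 1 else 0) +
      ∑ d1 : Fin N, ∑ d2 : Fin N,
        if (IsCircle b d1 d2 ∧ la = swapC b d1 d2) ∧ la = a ∧ la = c then
          (cCoef b d1 d2 i j : F) else 0 := by
  unfold gD
  simp only [finsum_eq_sum_of_fintype, Finsupp.add_apply, Finsupp.finsetSum_apply]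
  congr 1
  · rw [Finsupp.single_apply]
    congr 1
    simp only [Prod.mk.injEq, eq_iff_iff]
    tauto
  · rw [Finset.sum_eq_single b]
    · refine Finset.sum_congr rfl fun d1 _ => Finset.sum_congr rfl fun d2 _ => ?_
      by_cases h : IsCircle b d1 d2 ∧ la = swapC b d1 d2
      · rw [if_pos h, Finsupp.smul_apply, Finsupp.single_apply]
        by_cases h' : la = a ∧ la = c
        · rw [if_pos (by simp [h'.1.symm, h'.2.symm]), if_pos ⟨h, h'⟩]
          simp
        · rw [if_neg (by simpa using h'), if_neg (fun x => h' x.2)]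
          simp
      · rw [if_neg h, if_neg (fun x => h x.1)]; rfl
    · intro b' _ hb
      refine Finset.sum_eq_zero fun d1 _ => Finset.sum_eq_zero fun d2 _ => ?_
      split_ifs
      · rw [Finsupp.smul_apply, Finsupp.single_apply, if_neg]
        · simp
        · simp [hb]
      · rfl
    · simp

theorem gD_other (F : Type*) [Field F] {la a b c : Wt N} {i j : Fin N} (h : ¬ (la = a ∧ la = c)) :
    gD F la i j (a, b, c) = 0 := by
  rw [gD_apply, if_neg (fun x => h ⟨x.1, x.2.1⟩), zero_add]
  refine Finset.sum_eq_zero fun d1 _ => Finset.sum_eq_zero fun d2 _ => ?_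
  rw [if_neg (fun x => h x.2)]

theorem gD_none (F : Type*) [Field F] {la b : Wt N} {i j : Fin N} (hC : IsCircle la i j)
    (h : ¬ GammaAdj la b) : gD F la i j (la, b, la) = 0 := by
  rw [gD_apply, if_neg, zero_add]
  · refine Finset.sum_eq_zero fun d1 _ => Finset.sum_eq_zero fun d2 _ => ?_
    rw [if_neg]
    rintro ⟨⟨h1, h2⟩, -⟩
    exact h (Or.inr ⟨d1, d2, h1, h2⟩)
  · rintro ⟨-, -, h2⟩
    exact h (Or.inl ⟨i, j, hC, h2.symm⟩)

theorem gD_up (F : Type*) [Field F] {la : Wt N} {i j i' j' : Fin N} (hC : IsCircle la i j)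
    (hC' : IsCircle la i' j') :
    gD F la i j (la, swapC la i' j', la) = if i' = i ∧ j' = j then 1 else 0 := by
  rw [gD_apply]
  have : (∑ d1 : Fin N, ∑ d2 : Fin N,
        if (IsCircle (swapC la i' j') d1 d2 ∧ la = swapC (swapC la i' j') d1 d2) ∧ la = la ∧ la = la
        then (cCoef (swapC la i' j') d1 d2 i j : F) else 0) = 0 := by
    refine Finset.sum_eq_zero fun d1 _ => Finset.sum_eq_zero fun d2 _ => ?_
    rw [if_neg]
    rintro ⟨⟨h1, h2⟩, -⟩
    exact up_down hC' h1 h2 rfl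
  rw [this, add_zero]
  congr 1
  simp only [true_and, eq_iff_iff]
  constructor
  · intro h
    obtain ⟨a, b⟩ := circle_inj hC hC' h
    exact ⟨a.symm, b.symm⟩
  · rintro ⟨rfl, rfl⟩; rfl

theorem gD_down (F : Type*) [Field F] {la ka : Wt N} {i j d1 d2 : Fin N} (hC : IsCircle la i j)
    (hD : IsCircle ka d1 d2) (e : la = swapC ka d1 d2) :
    gD F la i j (la, ka, la) = (cCoef ka d1 d2 i j : F) := by
  rw [gD_apply, if_neg, zero_add, Finset.sum_eq_single d1, Finset.sum_eq_single d2]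
  · rw [if_pos ⟨⟨hD, e⟩, rfl, rfl⟩]
  · intro x _ hx
    rw [if_neg]
    rintro ⟨⟨h1, h2⟩, -⟩
    exact hx (down_inj hD h1 e h2).2.symm
  · simp
  · intro x _ hx
    refine Finset.sum_eq_zero fun y _ => ?_
    rw [if_neg]
    rintro ⟨⟨h1, h2⟩, -⟩
    exact hx (down_inj hD h1 e h2).1.symm
  · simp
  · rintro ⟨-, -, h⟩
    exact up_down hC hD e h.symm

theorem Orth.gA {F : Type*} [Field F] {m n : ℕ} {la mu : Wt N} (hne : la ≠ mu)
    (h2 : 2 ≤ {nu : Wt N | GammaAdj la nu ∧ GammaAdj nu mu}.ncard) :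
    Orth F m n N (gA F la mu) := by
  have key : ∀ l v w : Wt N, TI l v w → Kh.gA F la mu (l, v, w) = 0 := by
    intro l v w h
    rw [gA_apply, if_neg]
    rintro ⟨rfl, rfl, -⟩
    have : {nu : Wt N | GammaAdj la nu ∧ GammaAdj nu mu} ⊆ {v} := fun x hx => h.uniq hx.1 hx.2
    have := Set.ncard_le_ncard this
    rw [Set.ncard_singleton] at this
    omega
  refine ⟨fun l v w h _ => ⟨key _ _ _ (Or.inl h), key _ _ _ (Or.inr h)⟩, ?_, ?_⟩
  · intro l w v v' _ _ _ a b c d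
    rw [gA_apply, gA_apply]
    congr 1
    simp only [gammaAdj_symm a, gammaAdj_symm b, gammaAdj_symm c, gammaAdj_symm d]
  · intro l ka d1 d2 _ _ _
    have : ∀ b, Kh.gA F la mu (l, b, l) = 0 := by
      intro b
      rw [gA_apply, if_neg]
      rintro ⟨rfl, rfl, -⟩
      exact hne rfl
    simp [this]

theorem Orth.single {F : Type*} [Field F] {m n : ℕ} {l0 v0 w0 : Wt N} (hne : l0 ≠ w0)
    (hT : ¬ TI l0 v0 w0) (hu : ∀ v', GammaAdj l0 v' → GammaAdj v' w0 → v' = v0) :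
    Orth F m n N (Finsupp.single (l0, v0, w0) 1) := by
  have key : ∀ l v w : Wt N, TI l v w → (Finsupp.single (l0, v0, w0) 1 : T3 N →₀ F) (l, v, w) = 0 := by
    intro l v w h
    rw [Finsupp.single_apply, if_neg]
    intro e
    simp only [Prod.mk.injEq] at e
    obtain ⟨rfl, rfl, rfl⟩ := e
    exact hT h
  refine ⟨fun l v w h _ => ⟨key _ _ _ (Or.inl h), key _ _ _ (Or.inr h)⟩, ?_, ?_⟩
  · intro l w v v' _ _ _ a b c d
    rw [Finsupp.single_apply, Finsupp.single_apply]
    congr 1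
    simp only [Prod.mk.injEq, eq_iff_iff]
    constructor
    · rintro ⟨rfl, rfl, rfl⟩
      exact ⟨rfl, (hu _ (gammaAdj_symm d) (gammaAdj_symm c)).symm, rfl⟩
    · rintro ⟨rfl, rfl, rfl⟩
      exact ⟨rfl, (hu _ (gammaAdj_symm b) (gammaAdj_symm a)).symm, rfl⟩
  · intro l ka d1 d2 _ _ _
    have : ∀ b, (Finsupp.single (l0, v0, w0) 1 : T3 N →₀ F) (l, b, l) = 0 := by
      intro b
      rw [Finsupp.single_apply, if_neg]
      intro e
      simp only [Prod.mk.injEq] at e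
      exact hne (e.1.trans e.2.2.symm)
    simp [this]

theorem sum_circle {F : Type*} [Field F] (P : Fin N → Fin N → Prop) (f : Fin N → Fin N → F)
    (i j : Fin N) (h : P i j) :
    (∑ i' : Fin N, ∑ j' : Fin N,
      if P i' j' then f i' j' * (if i' = i ∧ j' = j then 1 else 0) else 0) = f i j := by
  rw [Finset.sum_eq_single i, Finset.sum_eq_single j]
  · simp [h]
  · intro x _ hx; simp [hx]
  · simp
  · intro x _ hx; simp [hx]
  · simp

theorem Orth.gD {F : Type*} [Field F] {m n : ℕ} {la : Wt N} {i j : Fin N} (hC : IsCircle la i j) :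
    Orth F m n N (gD F la i j) := by
  refine ⟨?_, ?_, ?_⟩
  · intro l v w h _
    have := TI.ne (Or.inl h)
    constructor
    · exact gD_other F (fun e => this (e.1.symm.trans e.2))
    · exact gD_other F (fun e => this (e.2.symm.trans e.1))
  · intro l w v v' _ _ hne _ _ _ _
    rw [gD_other F (fun e => hne (e.2.symm.trans e.1)), gD_other F (fun e => hne (e.2.symm.trans e.1))]
  · intro l ka d1 d2 _ hD e
    by_cases hl : la = l
    · subst hl
      rw [gD_down F hC hD e]
      rw [← sum_circle (IsCircle la) (fun i j => (cCoef ka d1 d2 i j : F)) i j hC]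
      refine Finset.sum_congr rfl fun i' _ => Finset.sum_congr rfl fun j' _ => ?_
      split_ifs with h1 h2
      · rw [gD_up F hC h1, if_pos h2]
      · rw [gD_up F hC h1, if_neg h2]
      · rfl
    · have : ∀ b, Kh.gD F la i j (l, b, l) = 0 := fun b => gD_other F (fun e => hl e.1)
      simp [this]

theorem Orth.of_gen {F : Type*} [Field F] {m n : ℕ} {f : T3 N →₀ F} (h : f ∈ GensIbar F m n N) :
    Orth F m n N f := by
  rcases h with ⟨la, mu, -, -, hne, h2, rfl⟩ | ⟨la, i, j, i', j', -, c1, c2, he, hno, h⟩ |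
    ⟨la, mu, c1, c2, d1, d2, -, -, hne, a, b, e, hc, rfl⟩ | ⟨la, i, j, -, hC, rfl⟩
  · exact Orth.gA hne h2
  · have T : TB0 la (swapC la i j) (swapC (swapC la i j) i' j') :=
      ⟨i, j, i', j', c1, c2, he, hno, rfl, rfl⟩
    have hne : ∀ {l v w : Wt N}, TB l v w → l ≠ w := by
      intro l v w h
      obtain ⟨-, -, q, -, -, -, -, -, hq, -⟩ := h.adj
      exact ne_of_app q hq
    rcases h with rfl | rfl
    · have T' : TB _ _ _ := Or.inl T
      exact Orth.single (hne T') (fun h => h.not_three T'.adj) (fun v' => T'.uniq)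
    · have T' : TB (swapC (swapC la i j) i' j') (swapC la i j) la := Or.inr T
      exact Orth.single (hne T') (fun h => h.not_three T'.adj) (fun v' => T'.uniq)
  · have T : TC la (swapC la c1 c2) mu := ⟨c1, c2, d1, d2, hne, a, b, rfl, e, hc⟩
    exact Orth.single hne (fun h => h.not_three T.adj) (fun v' => T.uniq)
  · exact Orth.gD hC

theorem Orth.of_span {F : Type*} [Field F] {m n : ℕ} {f : T3 N →₀ F}
    (h : f ∈ Submodule.span F (GensIbar F m n N)) : Orth F m n N f := by
  rw [← orth_iff]
  intro r hr
  induction h using Submodule.span_induction with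
  | mem x hx => exact (orth_iff F m n N x).2 (Orth.of_gen hx) r hr
  | zero => simp
  | add x y _ _ hx hy =>
    rw [finsum_eq_sum_of_fintype] at *
    simp only [Finsupp.add_apply, mul_add, Finset.sum_add_distrib, hx, hy, add_zero]
  | smul a x _ hx =>
    rw [finsum_eq_sum_of_fintype] at *
    simp only [Finsupp.smul_apply, smul_eq_mul, mul_left_comm _ a, ← Finset.mul_sum, hx, mul_zero]

theorem deg2_supp {F : Type*} [Field F] {m n : ℕ} {p : T3 N →₀ F} (hp : p ∈ Deg2 F m n N)
    {t : T3 N} (ht : p t ≠ 0) : IsPathTriple m n t := by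
  by_contra hcon
  apply ht
  clear ht
  induction hp using Submodule.span_induction with
  | mem x hx =>
    obtain ⟨t', h', rfl⟩ := hx
    rw [Finsupp.single_apply, if_neg]
    rintro rfl
    exact hcon h'
  | zero => simp
  | add x y _ _ hx hy => simp [hx, hy]
  | smul a x _ hx => simp [hx]

theorem decomp {F : Type*} [Field F] (p : T3 N →₀ F) :
    p = ∑ a : Wt N, ∑ c : Wt N, ∑ b : Wt N, Finsupp.single (a, b, c) (p (a, b, c)) := by
  ext ⟨a, b, c⟩
  simp only [Finsupp.finsetSum_apply, Finsupp.single_apply]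
  rw [Finset.sum_eq_single a, Finset.sum_eq_single c, Finset.sum_eq_single b]
  · simp
  · intro x _ hx; simp [hx]
  · simp
  · intro x _ hx; simp [hx]
  · simp
  · intro x _ hx; simp [hx]
  · simp

theorem slice_apply {F : Type*} [Field F] (p : T3 N →₀ F) (a c a' b' c' : Wt N) :
    (∑ b : Wt N, Finsupp.single (a, b, c) (p (a, b, c))) (a', b', c') =
      if a = a' ∧ c = c' then p (a', b', c') else 0 := by
  simp only [Finsupp.finsetSum_apply, Finsupp.single_apply]
  rw [Finset.sum_eq_single b']
  · by_cases h : a = a' ∧ c = c'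
    · obtain ⟨rfl, rfl⟩ := h; simp
    · rw [if_neg h, if_neg]; simpa using h
  · intro x _ hx; simp [hx]
  · simp

theorem span_of_orth {F : Type*} [Field F] {m n : ℕ} {p : T3 N →₀ F} (hp : p ∈ Deg2 F m n N)
    (ho : Orth F m n N p) : p ∈ Submodule.span F (GensIbar F m n N) := by
  obtain ⟨o1, o2, o3⟩ := ho
  rw [decomp p]
  refine Submodule.sum_mem _ fun a _ => Submodule.sum_mem _ fun c _ => ?_
  by_cases hac : a = c
  · subst hac
    by_cases ha : IsWeight m n a
    · have : (∑ b : Wt N, Finsupp.single (a, b, a) (p (a, b, a))) =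
          ∑ i : Fin N, ∑ j : Fin N,
            if IsCircle a i j then p (a, swapC a i j, a) • gD F a i j else 0 := by
        ext ⟨a', b, c'⟩
        rw [slice_apply]
        simp only [Finsupp.finsetSum_apply]
        by_cases h : a = a' ∧ a = c'
        · obtain ⟨rfl, rfl⟩ := h
          rw [if_pos ⟨rfl, rfl⟩]
          by_cases hab : GammaAdj a b
          · rcases hab with ⟨i, j, hC, rfl⟩ | ⟨d1, d2, hD, hE⟩
            · rw [← sum_circle (IsCircle a) (fun i j => p (a, swapC a i j, a)) i j hC]
              refine Finset.sum_congr rfl fun i' _ => Finset.sum_congr rfl fun j' _ => ?_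
              by_cases h1 : IsCircle a i' j'
              · rw [if_pos h1, if_pos h1, Finsupp.smul_apply, gD_up F h1 hC, smul_eq_mul]
                congr 2
                simp only [eq_iff_iff]
                exact ⟨fun h => ⟨h.1.symm, h.2.symm⟩, fun h => ⟨h.1.symm, h.2.symm⟩⟩
              · rw [if_neg h1, if_neg h1]; rfl
            · rw [o3 a b d1 d2 ha hD hE]
              refine Finset.sum_congr rfl fun i' _ => Finset.sum_congr rfl fun j' _ => ?_
              by_cases h1 : IsCircle a i' j'
              · rw [if_pos h1, if_pos h1, Finsupp.smul_apply, gD_down F h1 hD hE, smul_eq_mul,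
                  mul_comm]
              · rw [if_neg h1, if_neg h1]; rfl
          · have : p (a, b, a) = 0 := by
              by_contra h
              exact hab (deg2_supp hp h).2.2.2.1
            rw [this]
            symm
            refine Finset.sum_eq_zero fun i' _ => Finset.sum_eq_zero fun j' _ => ?_
            by_cases h1 : IsCircle a i' j'
            · rw [if_pos h1, Finsupp.smul_apply, gD_none F h1 hab, smul_zero]
            · rw [if_neg h1]; rfl
        · rw [if_neg h]
          symm
          refine Finset.sum_eq_zero fun i' _ => Finset.sum_eq_zero fun j' _ => ?_
          split_ifs
          · rw [Finsupp.smul_apply, gD_other F h, smul_zero]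
          · rfl
      rw [this]
      refine Submodule.sum_mem _ fun i _ => Submodule.sum_mem _ fun j _ => ?_
      split_ifs with h1
      · exact Submodule.smul_mem _ _ (Submodule.subset_span
          (Or.inr (Or.inr (Or.inr ⟨a, i, j, ha, h1, rfl⟩))))
      · exact Submodule.zero_mem _
    · refine Submodule.sum_mem _ fun b _ => ?_
      have : p (a, b, a) = 0 := by
        by_contra h
        exact ha (deg2_supp hp h).1
      rw [this, Finsupp.single_zero]
      exact Submodule.zero_mem _
  · by_cases hz : ∀ b, p (a, b, c) = 0
    · simp [hz]
    · push Not at hz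
      obtain ⟨v, hv⟩ := hz
      obtain ⟨wa, wv, wc, g1, g2⟩ := deg2_supp hp hv
      simp only at wa wv wc g1 g2
      by_cases hA : Alt a v c
      · obtain ⟨v', k1, k2, k3⟩ := hA
        have : (∑ b : Wt N, Finsupp.single (a, b, c) (p (a, b, c))) = p (a, v, c) • gA F a c := by
          ext ⟨a', b, c'⟩
          rw [slice_apply, Finsupp.smul_apply, gA_apply]
          by_cases h : a = a' ∧ c = c'
          · obtain ⟨rfl, rfl⟩ := h
            rw [if_pos ⟨rfl, rfl⟩]
            by_cases h' : GammaAdj a b ∧ GammaAdj b c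
            · rw [if_pos ⟨rfl, rfl, h'⟩]
              rw [o2 c a b v wc wa (Ne.symm hac) (gammaAdj_symm h'.2) (gammaAdj_symm h'.1)
                (gammaAdj_symm g2) (gammaAdj_symm g1)]
              simp
            · rw [if_neg (fun x => h' x.2.2), smul_zero]
              by_contra hh
              exact h' (deg2_supp hp hh).2.2.2
          · rw [if_neg h, if_neg (fun x => h ⟨x.1, x.2.1⟩), smul_zero]
        rw [this]
        refine Submodule.smul_mem _ _ (Submodule.subset_span (Or.inl ⟨a, c, wa, wc, hac, ?_, rfl⟩))
        have hs : ({v, v'} : Set (Wt N)) ⊆ {nu : Wt N | GammaAdj a nu ∧ GammaAdj nu c} := by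
          intro x hx
          rcases hx with rfl | rfl
          · exact ⟨g1, g2⟩
          · exact ⟨k1, k2⟩
        have := Set.ncard_le_ncard hs
        rwa [Set.ncard_pair k3.symm] at this
      · have : (∑ b : Wt N, Finsupp.single (a, b, c) (p (a, b, c))) =
            p (a, v, c) • Finsupp.single (a, v, c) 1 := by
          rw [Finset.sum_eq_single v]
          · simp
          · intro b _ hb
            have : p (a, b, c) = 0 := by
              by_contra hh
              obtain ⟨-, -, -, k⟩ := deg2_supp hp hh
              exact hA ⟨b, k.1, k.2, hb⟩
            rw [this, Finsupp.single_zero]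
          · simp
        rw [this]
        refine Submodule.smul_mem _ _ (Submodule.subset_span ?_)
        rcases exists_alt hac g1 g2 with h | (h | h) | (h | h) | h
        · exact (hA h).elim
        · exact (hv (o1 _ _ _ h wa).1).elim
        · exact (hv (o1 _ _ _ h wc).2).elim
        · obtain ⟨i, j, i', j', c1, c2, he, hno, rfl, rfl⟩ := h
          exact Or.inr (Or.inl ⟨a, i, j, i', j', wa, c1, c2, he, hno, Or.inl rfl⟩)
        · obtain ⟨i, j, i', j', c1, c2, he, hno, rfl, rfl⟩ := h
          exact Or.inr (Or.inl ⟨c, i, j, i', j', wc, c1, c2, he, hno, Or.inr rfl⟩)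
        · obtain ⟨c1, c2, d1, d2, -, k1, k2, rfl, k4, k5⟩ := h
          exact Or.inr (Or.inr (Or.inl ⟨a, c, c1, c2, d1, d2, wa, wc, hac, k1, k2, k4, k5, rfl⟩))

end Kh

namespace Kh

/-- A degree-2 element `p` of `kQ̄_m^n` lies in the span of the
quadratic generators (A)–(D) of `Ī_m^n` if and only if `⟨r, p⟩ = 0` for every `r`
in the span of the quadratic generators (i)–(iii) of `I_m^n`, where
`⟨r, p⟩ = Σ_t r t · p (rev3 t)` is the pairing `⟨a₁a₂, b̄₂b̄₁⟩ = δ δ`. -/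
theorem statement15 (F : Type*) [Field F] (m n : ℕ) (hm : 1 ≤ m) (hn : 1 ≤ n)
    (N : ℕ) (hN : N = m + n) :
    ∀ p : T3 N →₀ F, p ∈ Deg2 F m n N →
      (p ∈ Submodule.span F (GensIbar F m n N) ↔
        ∀ r ∈ Submodule.span F (GensI F m n N),
          (∑ᶠ t : T3 N, r t * p (rev3 t)) = 0) := by
  intro p hp
  rw [orth_iff]
  exact ⟨Orth.of_span, span_of_orth hp⟩

end Kh
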